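/- arXiv:2512.09624 — 2 statements merged into one kernel-verified Lean document; each statement's English description precedes it below -/
import Mathlib

section
/- Let f be a C² local diffeomorphism of 𝕋² such that det(Df_x) = deg(f) for every x∈𝕋² and I_f(x) > 0 for every x∈𝕋² (so f belongs to the class ℱ₀; in particular f preserves Lebesgue measure), and suppose the system (f, Leb) is ergodic. Then for every regular C² curve σ:[0,1]→𝕋² (σ'(t) ≠ 0 for all t), the set ⋃_{n≥0} f^{−n}(σ([0,1])) is dense in 𝕋². -/
open MeasureTheory Filter Topology Set
open scoped ENNReal NNReal

noncomputable section


open MeasureTheory Filter Topology Set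
open scoped ENNReal NNReal

noncomputable section

instance fact_zero_lt_one' : Fact ((0:ℝ) < 1) := ⟨one_pos⟩

/-- The plane `ℝ²` with the Euclidean norm: the universal cover of the 2-torus and the
common model of all its tangent spaces. -/
abbrev V2 : Type := EuclideanSpace ℝ (Fin 2)

/-- The flat 2-torus `𝕋² = ℝ²/ℤ²`. -/
abbrev T2 : Type := AddCircle (1 : ℝ) × AddCircle (1 : ℝ)

/-- The covering projection `ℝ² → 𝕋²`. -/
def proj (p : V2) : T2 := (↑(p 0), ↑(p 1))

/-- The integer vector `(m 0, m 1)` as an element of the plane. -/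
def iv (m : Fin 2 → ℤ) : V2 := (WithLp.equiv 2 (Fin 2 → ℝ)).symm (fun i => (m i : ℝ))

/-- A `C^r` local diffeomorphism of the 2-torus, encoded by a `C^r` lift `F : ℝ² → ℝ²`
equivariant with respect to an integer linear part `A`, together with the induced map
`toFun` on the torus and its derivative cocycle `D` (tangent spaces being canonically `ℝ²`);
invertibility of `D` at every point expresses that the map is a local diffeomorphism. -/
structure TorusMap (r : ℕ) : Type where
  F : V2 → V2
  contDiff : ContDiff ℝ r F
  A : Matrix (Fin 2) (Fin 2) ℤ
  equivar : ∀ (p : V2) (m : Fin 2 → ℤ), F (p + iv m) = F p + iv (A.mulVec m)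
  toFun : T2 → T2
  toFun_proj : ∀ p : V2, toFun (proj p) = proj (F p)
  D : T2 → (V2 →L[ℝ] V2)
  D_proj : ∀ p : V2, D (proj p) = fderiv ℝ F p
  isUnit_D : ∀ x : T2, IsUnit (D x)

namespace TorusMap

variable {r : ℕ}

/-- The degree of `f`: the number of preimages of any point, `|det A|`. -/
def deg (f : TorusMap r) : ℕ := f.A.det.natAbs

/-- The derivative of `f^[n]` at `x` (by the chain rule). -/
def Dn (f : TorusMap r) : ℕ → T2 → (V2 →L[ℝ] V2)
  | 0, _ => ContinuousLinearMap.id ℝ V2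
  | n + 1, x => (Dn f n (f.toFun x)).comp (f.D x)

/-- The inverse `(Df^n_x)⁻¹` of the derivative of `f^[n]` at `x`. -/
def Dninv (f : TorusMap r) (n : ℕ) (x : T2) : V2 →L[ℝ] V2 := Ring.inverse (f.Dn n x)

/-- `I(x,v;fⁿ) = d^{-n} ∑_{y ∈ f^{-n}(x)} log ‖(Dfⁿ_y)⁻¹ · v‖`. -/
def I (f : TorusMap r) (x : T2) (v : V2) (n : ℕ) : ℝ :=
  ((f.deg : ℝ) ^ n)⁻¹ * ∑ᶠ y ∈ (f.toFun^[n]) ⁻¹' {x}, Real.log ‖f.Dninv n y v‖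

/-- `inf_{(x,v) ∈ T¹𝕋²} I(x,v;fⁿ)`. -/
def unifInf (f : TorusMap r) (n : ℕ) : ℝ :=
  ⨅ xv : T2 × Metric.sphere (0 : V2) 1, f.I xv.1 (xv.2 : V2) n

/-- `C(f) = liminf_{n→∞} (1/n) inf_{(x,v) ∈ T¹𝕋²} I(x,v;fⁿ)`. -/
def C (f : TorusMap r) : ℝ := Filter.liminf (fun n : ℕ => f.unifInf n / n) Filter.atTop

/-- `I_f(x) = limsup_{n→∞} (1/n) inf_{v ∈ T¹_x𝕋²} I(x,v;fⁿ)`. -/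
def Isup (f : TorusMap r) (x : T2) : ℝ :=
  Filter.limsup (fun n : ℕ => (⨅ v : Metric.sphere (0 : V2) 1, f.I x (v : V2) n) / n)
    Filter.atTop

/-- The determinant of the derivative of `f` at `x`. -/
def detD (f : TorusMap r) (x : T2) : ℝ := LinearMap.det (f.D x : V2 →ₗ[ℝ] V2)

/-- `μ` is an `f`-invariant measure. -/
def Invariant (f : TorusMap r) (μ : Measure T2) : Prop :=
  ∀ s : Set T2, MeasurableSet s → μ (f.toFun ⁻¹' s) = μ s

/-- `μ` is equidistributed: `μ(f(A)) = d·μ(A)` for every Borel set `A` on which `f` is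
injective (equivalently, `μ` maximizes the folding entropy: `F_μ(f) = log d`). -/
def Equidistributed (f : TorusMap r) (μ : Measure T2) : Prop :=
  ∀ s : Set T2, MeasurableSet s → Set.InjOn f.toFun s →
    μ (f.toFun '' s) = (f.deg : ℝ≥0∞) * μ s

end TorusMap

/-- The minimal norm (conorm) of a linear map of the plane. -/
def minNorm (L : V2 →L[ℝ] V2) : ℝ := ⨅ v : Metric.sphere (0 : V2) 1, ‖L (v : V2)‖


theorem proj_add_iv (p : V2) (m : Fin 2 → ℤ) : proj (p + iv m) = proj p := by
  simp [proj, iv]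

theorem proj_eq_iff (p q : V2) : proj p = proj q ↔ ∃ m, q = p + iv m := by
  constructor
  · intro h
    simp only [proj, Prod.mk.injEq] at h
    obtain ⟨h0, h1⟩ := h
    rw [QuotientAddGroup.eq_iff_sub_mem, AddSubgroup.mem_zmultiples_iff] at h0 h1
    obtain ⟨a, ha⟩ := h0
    obtain ⟨b, hb⟩ := h1
    refine ⟨![-a, -b], ?_⟩
    ext i
    fin_cases i
    · simp [iv] at ha ⊢
      linarith
    · simp [iv] at hb ⊢
      linarith
  · rintro ⟨m, rfl⟩
    exact (proj_add_iv p m).symm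

theorem proj_surj : Function.Surjective proj := by
  rintro ⟨a, b⟩
  obtain ⟨a, rfl⟩ := QuotientAddGroup.mk_surjective a
  obtain ⟨b, rfl⟩ := QuotientAddGroup.mk_surjective b
  exact ⟨!₂[a, b], rfl⟩

theorem proj_localHomeo : IsLocalHomeomorph proj := by
  have h1 : IsLocalHomeomorph (fun p : ℝ × ℝ => ((p.1 : AddCircle (1:ℝ)), (p.2 : AddCircle (1:ℝ)))) := by
    rintro ⟨a, b⟩
    obtain ⟨e1, h1, h1'⟩ := AddCircle.isLocalHomeomorph_coe (1:ℝ) a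
    obtain ⟨e2, h2, h2'⟩ := AddCircle.isLocalHomeomorph_coe (1:ℝ) b
    refine ⟨e1.prod e2, ⟨h1, h2⟩, ?_⟩
    ext p
    · simp [← h1']
    · simp [← h2']
  let e : V2 ≃ₜ ℝ × ℝ := (PiLp.homeomorph 2 (fun _ : Fin 2 => ℝ)).trans (Homeomorph.finTwoArrow)
  exact h1.comp e.isLocalHomeomorph

theorem proj_cont : Continuous proj := proj_localHomeo.continuous


theorem exists_iv_box (p : V2) : ∃ m, ∀ i, (p + iv m) i ∈ Icc (0:ℝ) 1 := by
  refine ⟨fun i => -⌊p i⌋, fun i => ?_⟩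
  simp only [iv, PiLp.add_apply]
  have h1 := Int.floor_le (p i)
  have h2 := Int.lt_floor_add_one (p i)
  constructor <;> simp <;> linarith

/-- A continuous periodic function on the plane is bounded. -/
theorem bdd_of_periodic {E : Type*} [NormedAddCommGroup E] (h : V2 → E) (hc : Continuous h)
    (hp : ∀ p m, h (p + iv m) = h p) : ∃ C : ℝ, 0 < C ∧ ∀ p, ‖h p‖ ≤ C := by
  have hK : IsCompact ((PiLp.homeomorph 2 (fun _ : Fin 2 => ℝ)) ⁻¹' (Set.pi univ fun _ => Icc (0:ℝ) 1)) := by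
    rw [Homeomorph.isCompact_preimage]
    exact isCompact_univ_pi fun _ => isCompact_Icc
  obtain ⟨C, hC⟩ := hK.exists_bound_of_continuousOn hc.continuousOn
  refine ⟨max C 1, by positivity, fun p => ?_⟩
  obtain ⟨m, hm⟩ := exists_iv_box p
  rw [← hp p m]
  refine (hC _ ?_).trans (le_max_left _ _)
  intro i _
  exact hm i

namespace TorusMap

variable (f : TorusMap 2)

theorem F_diff : Differentiable ℝ f.F := f.contDiff.differentiable (by norm_num)

theorem F_cont : Continuous f.F := f.contDiff.continuous

theorem isUnit_fderiv (p : V2) : IsUnit (fderiv ℝ f.F p) := by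
  rw [← f.D_proj]; exact f.isUnit_D _

/-- The derivative as a continuous linear equivalence. -/
def DE (p : V2) : V2 ≃L[ℝ] V2 := ContinuousLinearEquiv.unitsEquiv ℝ V2 (f.isUnit_fderiv p).unit

theorem DE_coe (p : V2) : (f.DE p : V2 →L[ℝ] V2) = fderiv ℝ f.F p := by
  ext v; rfl

theorem DE_symm (p : V2) : ((f.DE p).symm : V2 →L[ℝ] V2) = Ring.inverse (fderiv ℝ f.F p) := by
  rw [← DE_coe, ContinuousLinearMap.ringInverse_equiv, ContinuousLinearMap.inverse_equiv]

theorem F_strict (p : V2) : HasStrictFDerivAt f.F (f.DE p : V2 →L[ℝ] V2) p := by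
  rw [DE_coe]
  exact f.contDiff.contDiffAt.hasStrictFDerivAt (by norm_num)

theorem F_localHomeo : IsLocalHomeomorph f.F := fun p =>
  ⟨(f.F_strict p).toOpenPartialHomeomorph f.F, (f.F_strict p).mem_toOpenPartialHomeomorph_source, rfl⟩

theorem toFun_localHomeo : IsLocalHomeomorph f.toFun := by
  have h : IsLocalHomeomorph (f.toFun ∘ proj) := by
    have : f.toFun ∘ proj = proj ∘ f.F := funext f.toFun_proj
    rw [this]
    exact proj_localHomeo.comp f.F_localHomeo
  have := (h.isLocalHomeomorphOn (s := univ)).of_comp_right proj_localHomeo.isLocalHomeomorphOn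
  rw [isLocalHomeomorph_iff_isLocalHomeomorphOn_univ]
  simpa [proj_surj.range_eq] using this

theorem toFun_cont : Continuous f.toFun := f.toFun_localHomeo.continuous

theorem toFun_cov : IsCoveringMap f.toFun := isLocalHomeomorph_iff_isCoveringMap.1 f.toFun_localHomeo

theorem fiber_finite (x : T2) : (f.toFun ⁻¹' {x}).Finite := by
  have hd := (f.toFun_cov x).discreteTopology_fiber
  have hc : IsCompact (f.toFun ⁻¹' {x}) := (isClosed_singleton.preimage f.toFun_cont).isCompact
  exact hc.finite (isDiscrete_iff_discreteTopology.2 hd)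

theorem F_iter_equivar (n : ℕ) (p : V2) (m : Fin 2 → ℤ) :
    f.F^[n] (p + iv m) = f.F^[n] p + iv ((f.A ^ n).mulVec m) := by
  induction n generalizing p m with
  | zero => simp
  | succ n ih =>
    rw [Function.iterate_succ_apply, f.equivar, ih, Function.iterate_succ_apply, pow_succ,
      Matrix.mulVec_mulVec]

theorem F_iter_contDiff (n : ℕ) : ContDiff ℝ (2:ℕ) (f.F^[n]) := by
  induction n with
  | zero => exact contDiff_id
  | succ n ih => rw [Function.iterate_succ]; exact ih.comp f.contDiff

theorem Dn_proj (n : ℕ) (p : V2) : f.Dn n (proj p) = fderiv ℝ (f.F^[n]) p := by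
  induction n generalizing p with
  | zero => simp [Dn]
  | succ n ih =>
    rw [Function.iterate_succ, fderiv_comp _ ((f.F_iter_contDiff n).differentiable (by norm_num) _)
      (f.F_diff _), Dn, f.toFun_proj, ih, f.D_proj]

theorem Dn_unit (n : ℕ) (x : T2) : IsUnit (f.Dn n x) := by
  induction n generalizing x with
  | zero => exact isUnit_one
  | succ n ih => exact (ih _).mul (f.isUnit_D x)

/-- The iterate of a torus map. -/
def iter (n : ℕ) : TorusMap 2 where
  F := f.F^[n]
  contDiff := f.F_iter_contDiff n
  A := f.A ^ n
  equivar := f.F_iter_equivar n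
  toFun := f.toFun^[n]
  toFun_proj p := by
    induction n generalizing p with
    | zero => rfl
    | succ n ih => rw [Function.iterate_succ_apply, f.toFun_proj, ih, Function.iterate_succ_apply]
  D := f.Dn n
  D_proj := f.Dn_proj n
  isUnit_D := f.Dn_unit n

theorem iter_deg (n : ℕ) : (f.iter n).deg = f.deg ^ n := by
  simp [deg, iter, Matrix.det_pow, Int.natAbs_pow]

theorem iter_det (hjac : ∀ x : T2, f.detD x = (f.deg : ℝ)) (n : ℕ) (x : T2) :
    (f.iter n).detD x = ((f.iter n).deg : ℝ) := by
  rw [iter_deg]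
  induction n generalizing x with
  | zero => simp [detD, iter, Dn]
  | succ n ih =>
    have h1 := ih (f.toFun x)
    have h2 := hjac x
    have : (f.iter (n+1)).detD x = (f.iter n).detD (f.toFun x) * f.detD x := by
      simp only [detD, iter, Dn]
      rw [← LinearMap.det_comp]; rfl
    rw [this, h1, h2]; push_cast; ring

theorem deg_pos (hjac : ∀ x : T2, f.detD x = (f.deg : ℝ)) : 0 < f.deg := by
  rcases Nat.eq_zero_or_pos f.deg with h | h
  · exfalso
    have h1 := hjac 0
    have h2 : IsUnit (LinearMap.det (f.D 0 : V2 →ₗ[ℝ] V2)) := by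
      have := (f.isUnit_D 0).map (ContinuousLinearMap.toLinearMapRingHom : (V2 →L[ℝ] V2) →+* _)
      exact LinearMap.isUnit_det _ this
    rw [detD] at h1
    rw [h1, h] at h2
    simp at h2
  · exact h

end TorusMap

/-- Fundamental domain. -/
def QQ : Set V2 := {p | p 0 ∈ Ioc (0:ℝ) 1 ∧ p 1 ∈ Ioc (0:ℝ) 1}

theorem proj_mp : MeasurePreserving proj ((volume : Measure V2).restrict QQ) volume := by
  have h1 := (AddCircle.measurePreserving_mk (1:ℝ) 0).prod (AddCircle.measurePreserving_mk (1:ℝ) 0)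
  rw [Measure.prod_restrict] at h1
  have e1 := (EuclideanSpace.volume_preserving_symm_measurableEquiv_toLp (Fin 2))
  have e2 := volume_preserving_finTwoArrow ℝ
  have e3 := e2.comp e1
  have e4 := e3.restrict_preimage (s := Ioc (0:ℝ) (0+1) ×ˢ Ioc (0:ℝ) (0+1))
    (measurableSet_Ioc.prod measurableSet_Ioc)
  have e5 := h1.comp e4
  have hQ : QQ = (⇑MeasurableEquiv.finTwoArrow ∘ ⇑(MeasurableEquiv.toLp 2 (Fin 2 → ℝ)).symm) ⁻¹'
      (Ioc (0:ℝ) (0 + 1) ×ˢ Ioc (0:ℝ) (0 + 1)) := by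
    ext p
    simp [QQ]
  rw [hQ]
  exact e5

theorem T2_vol_univ : (volume : Measure T2) univ = 1 := by
  rw [← univ_prod_univ]
  change (volume.prod volume) _ = 1
  rw [Measure.prod_prod, AddCircle.measure_univ]
  simp

instance T2_prob : IsProbabilityMeasure (volume : Measure T2) := ⟨T2_vol_univ⟩

theorem QQ_meas : MeasurableSet QQ := by
  unfold QQ
  have h0 : Measurable (fun p : V2 => p 0) := by fun_prop
  have h1 : Measurable (fun p : V2 => p 1) := by fun_prop
  exact (h0 measurableSet_Ioc).inter (h1 measurableSet_Ioc)

theorem iv_inj {m m' : Fin 2 → ℤ} (h : iv m = iv m') : m = m' := by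
  funext i
  have := congrArg (fun v : V2 => v i) h
  simpa [iv] using this

theorem QQ_unique {p : V2} {m m' : Fin 2 → ℤ} (h : p + iv m ∈ QQ) (h' : p + iv m' ∈ QQ) :
    m = m' := by
  simp only [QQ, iv, mem_ofPred_eq, mem_Ioc, PiLp.add_apply, WithLp.equiv_symm_apply_ofLp] at h h'
  have key : ∀ i : Fin 2, 0 < p i + (m i : ℝ) → p i + (m i : ℝ) ≤ 1 → 0 < p i + (m' i : ℝ) →
      p i + (m' i : ℝ) ≤ 1 → m i = m' i := by
    intro i a b c d
    have h1 : (m i : ℝ) < m' i + 1 := by linarith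
    have h2 : (m' i : ℝ) < m i + 1 := by linarith
    norm_cast at h1 h2
    omega
  funext i
  fin_cases i
  · exact key 0 h.1.1 h.1.2 h'.1.1 h'.1.2
  · exact key 1 h.2.1 h.2.2 h'.2.1 h'.2.2

theorem QQ_exists (p : V2) : ∃ m, p + iv m ∈ QQ := by
  refine ⟨fun i => 1 - ⌈p i⌉, ?_⟩
  have key : ∀ x : ℝ, 0 < x + (1 - ⌈x⌉) ∧ x + (1 - ⌈x⌉) ≤ 1 := by
    intro x
    have h1 := Int.le_ceil x
    have h2 := Int.ceil_lt_add_one x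
    constructor <;> linarith
  simp only [QQ, iv, mem_ofPred_eq, mem_Ioc, PiLp.add_apply, WithLp.equiv_symm_apply_ofLp]
  push_cast
  exact ⟨key _, key _⟩

theorem proj_image_meas {E : Set V2} (hE : MeasurableSet E) (hi : InjOn proj E) :
    MeasurableSet (proj '' E) :=
  hE.image_of_continuousOn_injOn proj_cont.continuousOn hi

theorem vol_proj_image {E : Set V2} (hE : MeasurableSet E) (hi : InjOn proj E) :
    volume (proj '' E) = volume E := by
  have h1 : volume (proj '' E) = volume (proj ⁻¹' (proj '' E) ∩ QQ) := by
    rw [← proj_mp.measure_preimage (proj_image_meas hE hi).nullMeasurableSet,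
      Measure.restrict_apply (proj_cont.measurable (proj_image_meas hE hi))]
  have h2 : proj ⁻¹' (proj '' E) ∩ QQ = ⋃ m : Fin 2 → ℤ, ((fun p => p + iv m) ⁻¹' E ∩ QQ) := by
    ext q
    simp only [mem_inter_iff, mem_preimage, mem_image, mem_iUnion]
    constructor
    · rintro ⟨⟨e, he, heq⟩, hq⟩
      obtain ⟨m, hm⟩ := (proj_eq_iff q e).1 heq.symm
      exact ⟨m, hm ▸ he, hq⟩
    · rintro ⟨m, hm, hq⟩
      exact ⟨⟨_, hm, proj_add_iv _ _⟩, hq⟩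
  have h3 : E = ⋃ m : Fin 2 → ℤ, (E ∩ (fun p => p + iv m) ⁻¹' QQ) := by
    rw [← inter_iUnion]
    refine (inter_eq_left.2 ?_).symm
    intro p _
    exact mem_iUnion.2 (QQ_exists p)
  have hadd : ∀ m, Measurable (fun p : V2 => p + iv m) := fun m => by fun_prop
  rw [h1, h2]
  conv_rhs => rw [h3]
  rw [measure_iUnion, measure_iUnion]
  · rw [← (Equiv.neg (Fin 2 → ℤ)).tsum_eq]
    congr 1
    funext m
    rw [← measure_preimage_add_right volume (iv m) ((fun p => p + iv ((Equiv.neg (Fin 2 → ℤ)) m)) ⁻¹' E ∩ QQ)]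
    congr 1
    ext p
    have : p + iv m + iv (-m) = p := by
      ext i; simp [iv]
    simp [this]
  · intro m m' hm
    rw [Function.onFun, Set.disjoint_left]
    rintro p ⟨_, h1⟩ ⟨_, h2⟩
    exact hm (QQ_unique h1 h2)
  · intro m
    exact hE.inter (hadd m QQ_meas)
  · intro m m' hm
    rw [Function.onFun, Set.disjoint_left]
    rintro p ⟨h1, _⟩ ⟨h2, _⟩
    have := hi h1 h2 (by rw [proj_add_iv, proj_add_iv])
    exact hm (iv_inj (add_left_cancel this))
  · intro m
    exact (hadd m hE).inter QQ_meas

namespace TorusMap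

variable (f : TorusMap 2)

theorem vol_image (hjac : ∀ x : T2, f.detD x = (f.deg : ℝ)) {B : Set T2} (hB : MeasurableSet B)
    (hi : InjOn f.toFun B) : volume (f.toFun '' B) = f.deg * volume B := by
  set E := proj ⁻¹' B ∩ QQ with hE
  have hEm : MeasurableSet E := (proj_cont.measurable hB).inter QQ_meas
  have hproj : InjOn proj E := by
    intro p hp q hq h
    obtain ⟨m, rfl⟩ := (proj_eq_iff p q).1 h
    have h0 : p + iv 0 = p := by ext i; simp [iv]
    have : (0 : Fin 2 → ℤ) = m := QQ_unique (by rw [h0]; exact hp.2) hq.2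
    rw [← this, h0]
  have hB1 : proj '' E = B := by
    ext x
    constructor
    · rintro ⟨p, hp, rfl⟩; exact hp.1
    · intro hx
      obtain ⟨p, rfl⟩ := proj_surj x
      obtain ⟨m, hm⟩ := QQ_exists p
      exact ⟨p + iv m, ⟨by simpa [proj_add_iv] using hx, hm⟩, proj_add_iv _ _⟩
  have hinj : InjOn (proj ∘ f.F) E := by
    have : proj ∘ f.F = f.toFun ∘ proj := (funext f.toFun_proj).symm
    rw [this]
    exact hi.comp hproj fun p hp => hp.1
  have hF : InjOn f.F E := hinj.of_comp
  have hprojF : InjOn proj (f.F '' E) := by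
    rintro _ ⟨p, hp, rfl⟩ _ ⟨q, hq, rfl⟩ h
    rw [hinj hp hq h]
  have him : f.toFun '' B = proj '' (f.F '' E) := by
    rw [← hB1, image_image, image_image]
    simp only [f.toFun_proj]
  have hFm : MeasurableSet (f.F '' E) := hEm.image_of_continuousOn_injOn f.F_cont.continuousOn hF
  rw [him, vol_proj_image hFm hprojF, ← hB1, vol_proj_image hEm hproj,
    ← lintegral_abs_det_fderiv_eq_addHaar_image volume hEm
      (fun x _ => (f.F_diff x).hasFDerivAt.hasFDerivWithinAt) hF]
  have : ∀ x, ENNReal.ofReal |(fderiv ℝ f.F x).det| = (f.deg : ℝ≥0∞) := by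
    intro x
    have h := hjac (proj x)
    rw [detD, f.D_proj] at h
    have h' : (fderiv ℝ f.F x).det = f.deg := h
    rw [h']; simp
  simp [this]

theorem count_integral (hjac : ∀ x : T2, f.detD x = (f.deg : ℝ)) {O : Set T2}
    (hO : MeasurableSet O) :
    ∫⁻ y, Measure.count (f.toFun ⁻¹' {y} ∩ O) ∂(volume : Measure T2) = f.deg * volume O := by
  have hloc : ∀ x : T2, ∃ U : Set T2, U ∈ 𝓝 x ∧ IsOpen U ∧ InjOn f.toFun U := by
    intro x
    obtain ⟨e, he, he'⟩ := f.toFun_localHomeo x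
    exact ⟨e.source, e.open_source.mem_nhds he, e.open_source, by rw [he']; exact e.injOn⟩
  choose U hU hUo hUi using hloc
  obtain ⟨s, hsc, hs⟩ := TopologicalSpace.countable_cover_nhds hU
  have hne : s.Nonempty := by
    rcases s.eq_empty_or_nonempty with h | h
    · rw [h] at hs
      simp only [mem_empty_iff_false, iUnion_of_empty, iUnion_empty] at hs
      exact absurd hs empty_ne_univ
    · exact h
  obtain ⟨e, rfl⟩ := hsc.exists_eq_range hne
  set B : ℕ → Set T2 := disjointed (fun i => U (e i)) with hBdef
  have hBm : ∀ i, MeasurableSet (B i) := fun i =>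
    MeasurableSet.disjointed (fun i => (hUo (e i)).measurableSet) i
  have hBd : Pairwise (Function.onFun Disjoint B) := disjoint_disjointed _
  have hBu : ⋃ i, B i = univ := by
    rw [hBdef, iUnion_disjointed, ← hs]; simp
  have hBi : ∀ i, InjOn f.toFun (B i) := fun i => (hUi (e i)).mono (disjointed_subset _ _)
  have hcm : ∀ i, MeasurableSet (f.toFun '' (B i ∩ O)) := fun i =>
    ((hBm i).inter hO).image_of_continuousOn_injOn f.toFun_cont.continuousOn
      ((hBi i).mono inter_subset_left)
  have hc : ∀ y, Measure.count (f.toFun ⁻¹' {y} ∩ O)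
      = ∑' i, indicator (f.toFun '' (B i ∩ O)) (1 : T2 → ℝ≥0∞) y := by
    intro y
    have hm : MeasurableSet (f.toFun ⁻¹' {y} ∩ O) :=
      (f.toFun_cont.measurable (measurableSet_singleton y)).inter hO
    have : f.toFun ⁻¹' {y} ∩ O = ⋃ i, (f.toFun ⁻¹' {y} ∩ O ∩ B i) := by
      rw [← inter_iUnion, hBu, inter_univ]
    rw [this, measure_iUnion]
    · congr 1
      funext i
      by_cases hy : y ∈ f.toFun '' (B i ∩ O)
      · obtain ⟨z, hz, rfl⟩ := hy
        have : f.toFun ⁻¹' {f.toFun z} ∩ O ∩ B i = {z} := by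
          ext w
          constructor
          · rintro ⟨⟨h1, _⟩, h2⟩
            exact hBi i h2 hz.1 h1
          · rintro rfl
            exact ⟨⟨rfl, hz.2⟩, hz.1⟩
        rw [this, Measure.count_singleton, indicator_of_mem (mem_image_of_mem _ hz)]; rfl
      · rw [indicator_of_notMem hy]
        convert measure_empty (μ := Measure.count)
        ext w
        simp only [mem_inter_iff, mem_preimage, mem_singleton_iff, mem_empty_iff_false, iff_false]
        rintro ⟨⟨h1, h2⟩, h3⟩
        exact hy ⟨w, ⟨h3, h2⟩, h1⟩
    · intro i j hij
      exact (hBd hij).mono inter_subset_right inter_subset_right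
    · intro i
      exact hm.inter (hBm i)
  simp_rw [hc]
  rw [lintegral_tsum (fun i => (measurable_one.indicator (hcm i)).aemeasurable)]
  have : ∀ i, ∫⁻ a, indicator (f.toFun '' (B i ∩ O)) (1 : T2 → ℝ≥0∞) a ∂(volume : Measure T2)
      = f.deg * volume (B i ∩ O) := by
    intro i
    rw [lintegral_indicator_one (hcm i),
      f.vol_image hjac ((hBm i).inter hO) ((hBi i).mono inter_subset_left)]
  simp_rw [this]
  rw [ENNReal.tsum_mul_left, ← measure_iUnion, ← iUnion_inter, hBu, univ_inter]
  · intro i j hij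
    exact (hBd hij).mono inter_subset_left inter_subset_left
  · exact fun i => (hBm i).inter hO

theorem ncard_fiber_const (x y : T2) : Nat.card (f.toFun ⁻¹' {x}) = Nat.card (f.toFun ⁻¹' {y}) := by
  have h : IsLocallyConstant (fun x : T2 => Nat.card (f.toFun ⁻¹' {x})) := by
    rw [IsLocallyConstant.iff_exists_open]
    intro x
    obtain ⟨hd, U, hxU, hU, hfU, H, hH⟩ := f.toFun_cov x
    refine ⟨U, hU, hxU, fun x' hx' => ?_⟩
    have h2 : IsEvenlyCovered f.toFun x' (f.toFun ⁻¹' {x}) := ⟨hd, U, hx', hU, hfU, H, hH⟩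
    exact (Nat.card_congr h2.fiberHomeomorph.toEquiv).symm
  exact h.apply_eq_of_preconnectedSpace x y

theorem card_fiber (hjac : ∀ x : T2, f.detD x = (f.deg : ℝ)) (x : T2) :
    (f.toFun ⁻¹' {x}).ncard = f.deg := by
  have h := f.count_integral hjac MeasurableSet.univ
  have hc : ∀ y, Measure.count (f.toFun ⁻¹' {y} ∩ univ) = ((f.toFun ⁻¹' {x}).ncard : ℝ≥0∞) := by
    intro y
    rw [inter_univ, Measure.count_apply_finite _ (f.fiber_finite y),
      ← Set.ncard_eq_toFinset_card _ (f.fiber_finite y), ← Nat.card_coe_set_eq, ← Nat.card_coe_set_eq,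
      f.ncard_fiber_const x y]
  simp_rw [hc] at h
  simpa using h

theorem vol_preimage (hjac : ∀ x : T2, f.detD x = (f.deg : ℝ)) {A : Set T2} (hA : MeasurableSet A) :
    volume (f.toFun ⁻¹' A) = volume A := by
  have h := f.count_integral hjac (f.toFun_cont.measurable hA)
  have hc : ∀ y, Measure.count (f.toFun ⁻¹' {y} ∩ f.toFun ⁻¹' A)
      = indicator A (fun _ => (f.deg : ℝ≥0∞)) y := by
    intro y
    by_cases hy : y ∈ A
    · have : f.toFun ⁻¹' {y} ∩ f.toFun ⁻¹' A = f.toFun ⁻¹' {y} := by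
        rw [inter_eq_left]; rintro z rfl; exact hy
      rw [this, indicator_of_mem hy, Measure.count_apply_finite _ (f.fiber_finite y),
        ← Set.ncard_eq_toFinset_card _ (f.fiber_finite y), f.card_fiber hjac]
    · have : f.toFun ⁻¹' {y} ∩ f.toFun ⁻¹' A = ∅ := by
        ext z
        simp only [mem_inter_iff, mem_preimage, mem_singleton_iff, mem_empty_iff_false, iff_false]
        rintro ⟨rfl, h⟩; exact hy h
      rw [this, indicator_of_notMem hy, measure_empty]
  simp_rw [hc] at h
  rw [lintegral_indicator_const hA] at h
  have hd := f.deg_pos hjac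
  exact ((ENNReal.mul_right_inj (by positivity) (by simp)).1 h).symm

theorem vol_ge (hjac : ∀ x : T2, f.detD x = (f.deg : ℝ)) {O B : Set T2} (hO : MeasurableSet O)
    (hB : MeasurableSet B)
    (h : ∀ y ∈ B, (f.deg : ℝ) / 2 ≤ (f.toFun ⁻¹' {y} ∩ O).ncard) :
    volume B ≤ 2 * volume O := by
  have h1 := f.count_integral hjac hO
  have h2 : (f.deg : ℝ≥0∞) * volume B ≤ 2 * (f.deg * volume O) := by
    rw [← h1, ← lintegral_indicator_const hB, ← lintegral_const_mul' _ _ (by simp)]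
    refine lintegral_mono fun y => ?_
    by_cases hy : y ∈ B
    · have hfin : (f.toFun ⁻¹' {y} ∩ O).Finite := (f.fiber_finite y).subset inter_subset_left
      have := h y hy
      rw [indicator_of_mem hy, Measure.count_apply_finite _ hfin, ← Set.ncard_eq_toFinset_card _ hfin]
      have h3 : (f.deg : ℝ) ≤ 2 * (f.toFun ⁻¹' {y} ∩ O).ncard := by linarith
      have h4 : f.deg ≤ 2 * (f.toFun ⁻¹' {y} ∩ O).ncard := by exact_mod_cast h3
      calc (f.deg : ℝ≥0∞) ≤ ((2 * (f.toFun ⁻¹' {y} ∩ O).ncard : ℕ) : ℝ≥0∞) := Nat.cast_le.2 h4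
        _ = _ := by push_cast; rfl
    · rw [indicator_of_notMem hy]; exact zero_le
  have hd := f.deg_pos hjac
  rw [mul_left_comm] at h2
  exact (ENNReal.mul_le_mul_iff_right (by positivity) (by simp)).1 h2

end TorusMap

/-- Area form on the plane. -/
def om (a b : V2) : ℝ := a 0 * b 1 - a 1 * b 0

/-- Inner product on the plane. -/
def ip (a b : V2) : ℝ := a 0 * b 0 + a 1 * b 1

theorem norm_sq_V2 (a : V2) : ‖a‖ ^ 2 = a 0 ^ 2 + a 1 ^ 2 := by
  rw [EuclideanSpace.norm_sq_eq]; simp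

theorem om_add (a b c : V2) : om a (b + c) = om a b + om a c := by simp [om]; ring
theorem om_sub (a b c : V2) : om a (b - c) = om a b - om a c := by simp [om]; ring
theorem om_smul (a b : V2) (t : ℝ) : om a (t • b) = t * om a b := by simp [om]; ring
theorem om_smul_left (a b : V2) (t : ℝ) : om (t • a) b = t * om a b := by simp [om]; ring
theorem ip_add (a b c : V2) : ip a (b + c) = ip a b + ip a c := by simp [ip]; ring
theorem ip_sub (a b c : V2) : ip a (b - c) = ip a b - ip a c := by simp [ip]; ring
theorem ip_smul (a b : V2) (t : ℝ) : ip a (t • b) = t * ip a b := by simp [ip]; ring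
theorem ip_smul_left (a b : V2) (t : ℝ) : ip (t • a) b = t * ip a b := by simp [ip]; ring
theorem ip_self (a : V2) : ip a a = ‖a‖ ^ 2 := by rw [norm_sq_V2]; simp [ip]; ring
theorem om_self (a : V2) : om a a = 0 := by simp [om]; ring

theorem ip_om_sq (a b : V2) : ip a b ^ 2 + om a b ^ 2 = (‖a‖ * ‖b‖) ^ 2 := by
  rw [mul_pow, norm_sq_V2, norm_sq_V2]; simp only [ip, om]; ring

theorem abs_om_le (a b : V2) : |om a b| ≤ ‖a‖ * ‖b‖ := by
  apply abs_le_of_sq_le_sq _ (by positivity)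
  rw [← ip_om_sq]; nlinarith [sq_nonneg (ip a b)]

theorem abs_ip_le (a b : V2) : |ip a b| ≤ ‖a‖ * ‖b‖ := by
  apply abs_le_of_sq_le_sq _ (by positivity)
  rw [← ip_om_sq]; nlinarith [sq_nonneg (om a b)]

theorem norm_le_ip_om {v : V2} (hv : ‖v‖ = 1) (p : V2) : ‖p‖ ≤ |ip v p| + |om v p| := by
  refine le_of_abs_le (abs_le_of_sq_le_sq ?_ (by positivity))
  have := ip_om_sq v p
  rw [hv, one_mul] at this
  rw [← this, add_sq, sq_abs, sq_abs]
  nlinarith [mul_nonneg (abs_nonneg (ip v p)) (abs_nonneg (om v p))]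

theorem norm_perp {v : V2} (hv : ‖v‖ = 1) (p : V2) : ‖p - ip v p • v‖ ≤ |om v p| := by
  refine (norm_le_ip_om hv _).trans ?_
  rw [ip_sub, ip_smul, ip_self, om_sub, om_smul, om_self, hv]
  simp

theorem om_det (L : V2 →L[ℝ] V2) (a b : V2) :
    om (L a) (L b) = LinearMap.det (L : V2 →ₗ[ℝ] V2) * om a b := by
  set e : Module.Basis (Fin 2) ℝ V2 := (EuclideanSpace.basisFun (Fin 2) ℝ).toBasis with he
  rw [← LinearMap.det_toMatrix e, Matrix.det_fin_two]
  have hM : ∀ i j, LinearMap.toMatrix e e (L : V2 →ₗ[ℝ] V2) i j = (L (e j)) i := by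
    intro i j
    rw [LinearMap.toMatrix_apply]
    simp [he]
  have hexp : ∀ a : V2, a = a 0 • e 0 + a 1 • e 1 := by
    intro a
    ext i
    fin_cases i <;> simp [he]
  simp only [hM]
  have h1 : L a = a 0 • L (e 0) + a 1 • L (e 1) := by
    conv_lhs => rw [hexp a]
    simp
  have h2 : L b = b 0 • L (e 0) + b 1 • L (e 1) := by
    conv_lhs => rw [hexp b]
    simp
  rw [h1, h2]
  simp only [om, PiLp.add_apply, PiLp.smul_apply, smul_eq_mul]
  ring

theorem ip_cont (v : V2) : Continuous (ip v) := by
  unfold ip; fun_prop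

/-- The set `S` contains (the projection of) a path crossing the `R × r` rectangle at `y` with
axis `v`. -/
def St (S : Set T2) (y v : V2) (r R : ℝ) : Prop :=
  ∃ (a b : ℝ) (γ : ℝ → V2), a ≤ b ∧ ContinuousOn γ (Icc a b) ∧
    (∀ t ∈ Icc a b, proj (γ t) ∈ S ∧ |om v (γ t - y)| ≤ r ∧ |ip v (γ t - y)| ≤ R) ∧
    ip v (γ a - y) = -R ∧ ip v (γ b - y) = R

theorem St.mk' {S : Set T2} {y v : V2} {r R : ℝ} (hR : 0 ≤ R) {a b : ℝ} {γ : ℝ → V2} (hab : a ≤ b)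
    (hc : ContinuousOn γ (Icc a b))
    (h : ∀ t ∈ Icc a b, proj (γ t) ∈ S ∧ |om v (γ t - y)| ≤ r)
    (ha : ip v (γ a - y) ≤ -R) (hb : R ≤ ip v (γ b - y)) : St S y v r R := by
  set s : ℝ → ℝ := fun t => ip v (γ t - y) with hs
  have hsc : ContinuousOn s (Icc a b) :=
    (ip_cont v).comp_continuousOn (hc.sub continuousOn_const)
  have hT : ({t ∈ Icc a b | s t = R}).Nonempty := by
    obtain ⟨t, ht, h⟩ := intermediate_value_Icc hab hsc (show R ∈ Icc (s a) (s b) from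
      ⟨by simp only [hs]; linarith, hb⟩)
    exact ⟨t, ht, h⟩
  have hTc : IsCompact ({t ∈ Icc a b | s t = R}) := by
    have : {t ∈ Icc a b | s t = R} = Icc a b ∩ s ⁻¹' {R} := rfl
    rw [this]
    exact isCompact_Icc.of_isClosed_subset
      (hsc.preimage_isClosed_of_isClosed isClosed_Icc isClosed_singleton) inter_subset_left
  obtain ⟨b', ⟨hb', hsb'⟩, hmin⟩ := hTc.exists_isLeast hT
  have hle : ∀ t ∈ Icc a b', s t ≤ R := by
    intro t ht
    by_contra hcon
    push Not at hcon
    obtain ⟨t', ht', h'⟩ := intermediate_value_Icc ht.1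
      (hsc.mono (Icc_subset_Icc_right (ht.2.trans hb'.2))) (show R ∈ Icc (s a) (s t) from
      ⟨by simp only [hs]; linarith, hcon.le⟩)
    have h1 := hmin ⟨⟨ht'.1, ht'.2.trans (ht.2.trans hb'.2)⟩, h'⟩
    have : t = b' := le_antisymm ht.2 (h1.trans ht'.2)
    rw [this] at hcon
    linarith
  have hsc' : ContinuousOn s (Icc a b') := hsc.mono (Icc_subset_Icc_right hb'.2)
  have hT2 : ({t ∈ Icc a b' | s t = -R}).Nonempty := by
    obtain ⟨t, ht, h⟩ := intermediate_value_Icc hb'.1 hsc' (show -R ∈ Icc (s a) (s b') from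
      ⟨ha, by linarith⟩)
    exact ⟨t, ht, h⟩
  have hTc2 : IsCompact ({t ∈ Icc a b' | s t = -R}) := by
    have : {t ∈ Icc a b' | s t = -R} = Icc a b' ∩ s ⁻¹' {-R} := rfl
    rw [this]
    exact isCompact_Icc.of_isClosed_subset
      (hsc'.preimage_isClosed_of_isClosed isClosed_Icc isClosed_singleton) inter_subset_left
  obtain ⟨a', ⟨ha', hsa'⟩, hmax⟩ := hTc2.exists_isGreatest hT2
  have hge : ∀ t ∈ Icc a' b', -R ≤ s t := by
    intro t ht
    by_contra hcon
    push Not at hcon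
    obtain ⟨t', ht', h'⟩ := intermediate_value_Icc ht.2
      (hsc'.mono (Icc_subset_Icc_left (ha'.1.trans ht.1))) (show -R ∈ Icc (s t) (s b') from
      ⟨hcon.le, by linarith⟩)
    have h1 := hmax ⟨⟨ha'.1.trans (ht.1.trans ht'.1), ht'.2⟩, h'⟩
    have : t = a' := le_antisymm (ht'.1.trans h1) ht.1
    rw [this] at hcon
    linarith
  refine ⟨a', b', γ, ha'.2, hc.mono (Icc_subset_Icc ha'.1 hb'.2), fun t ht => ?_, hsa', hsb'⟩
  have hh := h t ⟨ha'.1.trans ht.1, ht.2.trans hb'.2⟩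
  exact ⟨hh.1, hh.2, abs_le.2 ⟨hge t ht, hle t ⟨ha'.1.trans ht.1, ht.2⟩⟩⟩

theorem St.near {S : Set T2} {y v : V2} {r R : ℝ} (hv : ‖v‖ = 1) (hR : 0 ≤ R)
    (h : St S y v r R) : ∃ p, proj p ∈ S ∧ ‖p - y‖ ≤ r := by
  obtain ⟨a, b, γ, hab, hc, h, ha, hb⟩ := h
  have hsc : ContinuousOn (fun t => ip v (γ t - y)) (Icc a b) :=
    (ip_cont v).comp_continuousOn (hc.sub continuousOn_const)
  obtain ⟨t, ht, h'⟩ := intermediate_value_Icc hab hsc (show (0:ℝ) ∈ Icc _ _ from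
      ⟨by simp only [ha]; linarith, by simp only [hb]; exact hR⟩)
  refine ⟨γ t, (h t ht).1, (norm_le_ip_om hv _).trans ?_⟩
  simp only at h'
  rw [h', abs_zero, zero_add]
  exact (h t ht).2.1

theorem St.translate {S : Set T2} {y v : V2} {r R : ℝ} (h : St S y v r R) (m : Fin 2 → ℤ) :
    St S (y + iv m) v r R := by
  obtain ⟨a, b, γ, hab, hc, h, ha, hb⟩ := h
  have : ∀ t, γ t + iv m - (y + iv m) = γ t - y := fun t => by abel
  refine ⟨a, b, fun t => γ t + iv m, hab, hc.add continuousOn_const, fun t ht => ?_, ?_, ?_⟩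
  · rw [this, proj_add_iv]; exact h t ht
  · simp only [this]; exact ha
  · simp only [this]; exact hb

namespace TorusMap

variable (f : TorusMap 2)

theorem fderiv_periodic (p : V2) (m : Fin 2 → ℤ) :
    fderiv ℝ f.F (p + iv m) = fderiv ℝ f.F p := by
  rw [← f.D_proj, ← f.D_proj, proj_add_iv]

theorem fderiv_contDiff : ContDiff ℝ 1 (fderiv ℝ f.F) :=
  f.contDiff.fderiv_right (by norm_num)

theorem exists_consts : ∃ C : ℝ, 1 ≤ C ∧ (∀ p, ‖fderiv ℝ f.F p‖ ≤ C) ∧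
    (∀ p, ‖((f.DE p).symm : V2 →L[ℝ] V2)‖ ≤ C) ∧
    (∀ p q, ‖fderiv ℝ f.F p - fderiv ℝ f.F q‖ ≤ C * ‖p - q‖) := by
  obtain ⟨C1, h1, H1⟩ := bdd_of_periodic (fderiv ℝ f.F) f.fderiv_contDiff.continuous f.fderiv_periodic
  obtain ⟨C2, h2, H2⟩ := bdd_of_periodic (fun p => Ring.inverse (fderiv ℝ f.F p)) (by
    rw [continuous_iff_continuousAt]
    intro p
    have := NormedRing.inverse_continuousAt (f.isUnit_fderiv p).unit
    exact ContinuousAt.comp (g := Ring.inverse) this f.fderiv_contDiff.continuous.continuousAt)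
    (fun p m => by simp only [f.fderiv_periodic])
  obtain ⟨C3, h3, H3⟩ := bdd_of_periodic (fderiv ℝ (fderiv ℝ f.F))
    (f.fderiv_contDiff.continuous_fderiv (by norm_num)) (fun p m => by
      have : (fun q => fderiv ℝ f.F (q + iv m)) = fderiv ℝ f.F := funext fun q => f.fderiv_periodic q m
      conv_rhs => rw [← this]
      rw [fderiv_comp_add_right])
  refine ⟨max 1 (max C1 (max C2 C3)), le_max_left _ _, fun p => ?_, fun p => ?_, fun p q => ?_⟩
  · exact (H1 p).trans (by simp)
  · rw [DE_symm]; exact (H2 p).trans (by simp)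
  · refine (Convex.norm_image_sub_le_of_norm_fderiv_le (𝕜 := ℝ) (s := univ) (C := C3)
      (fun x _ => (f.fderiv_contDiff.differentiable (by norm_num)) x) (fun x _ => H3 x) convex_univ
      (mem_univ q) (mem_univ p)).trans ?_
    gcongr
    simp

theorem taylor {C : ℝ} (hC : ∀ p q, ‖fderiv ℝ f.F p - fderiv ℝ f.F q‖ ≤ C * ‖p - q‖)
    (hC0 : 0 ≤ C) (z : V2) {ρ : ℝ} {p q : V2} (hp : p ∈ Metric.closedBall z ρ)
    (hq : q ∈ Metric.closedBall z ρ) :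
    ‖f.F p - f.F q - fderiv ℝ f.F z (p - q)‖ ≤ C * ρ * ‖p - q‖ := by
  refine Convex.norm_image_sub_le_of_norm_fderiv_le' (𝕜 := ℝ) (s := Metric.closedBall z ρ)
    (fun x _ => f.F_diff x) (fun x hx => ?_) (convex_closedBall z ρ) hq hp
  refine (hC x z).trans ?_
  gcongr
  rw [← dist_eq_norm]; exact hx

theorem local_inv {C : ℝ} (hC1 : 1 ≤ C) (hinv : ∀ p, ‖((f.DE p).symm : V2 →L[ℝ] V2)‖ ≤ C)
    (hC : ∀ p q, ‖fderiv ℝ f.F p - fderiv ℝ f.F q‖ ≤ C * ‖p - q‖) (z : V2) :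
    ∃ k : V2 → V2, ContinuousOn k (Metric.closedBall (f.F z) (1 / (4 * C ^ 3))) ∧
      ∀ p ∈ Metric.closedBall (f.F z) (1 / (4 * C ^ 3)), f.F (k p) = p ∧
        ‖k p - z‖ ≤ 2 * C * ‖p - f.F z‖ ∧
        ‖(p - f.F z) - fderiv ℝ f.F z (k p - z)‖ ≤ C * ‖k p - z‖ ^ 2 := by
  have hC0 : 0 < C := by linarith
  set ρ : ℝ := 1 / (2 * C ^ 2) with hρ
  have hρ0 : 0 < ρ := by positivity
  have hCρ : C * ρ = 1 / (2 * C) := by rw [hρ]; field_simp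
  have hinvE : ∀ w, ‖w‖ ≤ C * ‖fderiv ℝ f.F z w‖ := by
    intro w
    have h1 : (f.DE z).symm (fderiv ℝ f.F z w) = w := by
      rw [← DE_coe]; simp
    calc ‖w‖ = ‖((f.DE z).symm : V2 →L[ℝ] V2) (fderiv ℝ f.F z w)‖ := by
          conv_lhs => rw [← h1]
          rfl
      _ ≤ ‖((f.DE z).symm : V2 →L[ℝ] V2)‖ * ‖fderiv ℝ f.F z w‖ := ContinuousLinearMap.le_opNorm _ _
      _ ≤ _ := by gcongr; exact hinv z
  have hanti : ∀ p ∈ Metric.closedBall z ρ, ∀ q ∈ Metric.closedBall z ρ,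
      ‖p - q‖ ≤ 2 * C * ‖f.F p - f.F q‖ := by
    intro p hp q hq
    have h1 := f.taylor hC hC0.le z hp hq
    rw [hCρ] at h1
    have h2 := hinvE (p - q)
    have h3 : ‖fderiv ℝ f.F z (p - q)‖ ≤ ‖f.F p - f.F q‖ + 1 / (2 * C) * ‖p - q‖ := by
      have := norm_sub_norm_le (fderiv ℝ f.F z (p - q)) (f.F p - f.F q)
      rw [norm_sub_rev (fderiv ℝ f.F z (p - q))] at this
      linarith
    have h4 : ‖p - q‖ ≤ C * ‖f.F p - f.F q‖ + 1 / 2 * ‖p - q‖ := by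
      calc ‖p - q‖ ≤ C * (‖f.F p - f.F q‖ + 1 / (2 * C) * ‖p - q‖) := h2.trans (by gcongr)
        _ = _ := by field_simp
    linarith
  have hsurj : ∀ p ∈ Metric.closedBall (f.F z) (1 / (4 * C ^ 3)),
      ∃ q ∈ Metric.closedBall z ρ, f.F q = p := by
    have hA : ApproximatesLinearOn f.F (fderiv ℝ f.F z) (Metric.closedBall z ρ)
        (⟨1 / (2 * C), by positivity⟩ : ℝ≥0) := by
      intro p hp q hq
      have := f.taylor hC hC0.le z hp hq
      rw [hCρ] at this
      exact this
    let N : (fderiv ℝ f.F z).NonlinearRightInverse :=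
      { toFun := (f.DE z).symm
        nnnorm := ⟨C, hC0.le⟩
        bound' := fun y => by
          refine (ContinuousLinearMap.le_opNorm ((f.DE z).symm : V2 →L[ℝ] V2) y).trans ?_
          exact mul_le_mul_of_nonneg_right (hinv z) (norm_nonneg _)
        right_inv' := fun y => by rw [← DE_coe]; simp }
    have hs := hA.surjOn_closedBall_of_nonlinearRightInverse N hρ0.le (subset_refl _)
    intro p hp
    refine hs ?_
    have hrad : (C⁻¹ - 1 / (2 * C)) * ρ = 1 / (4 * C ^ 3) := by
      rw [hρ]; field_simp; norm_num
    rw [Metric.mem_closedBall] at hp ⊢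
    exact hp.trans hrad.symm.le
  choose! k hk using hsurj
  have hz : z ∈ Metric.closedBall z ρ := Metric.mem_closedBall_self hρ0.le
  refine ⟨k, ?_, fun p hp => ⟨(hk p hp).2, ?_, ?_⟩⟩
  · have : LipschitzOnWith (⟨2 * C, by positivity⟩ : ℝ≥0) k
        (Metric.closedBall (f.F z) (1 / (4 * C ^ 3))) := by
      refine LipschitzOnWith.of_dist_le_mul fun p hp q hq => ?_
      have := hanti _ (hk p hp).1 _ (hk q hq).1
      rw [(hk p hp).2, (hk q hq).2] at this
      rw [dist_eq_norm, dist_eq_norm]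
      exact this
    exact this.continuousOn
  · have := hanti _ (hk p hp).1 _ hz
    rwa [(hk p hp).2] at this
  · have := f.taylor hC hC0.le z (ρ := ‖k p - z‖) (p := k p) (q := z)
      (by rw [Metric.mem_closedBall, dist_eq_norm]) (Metric.mem_closedBall_self (norm_nonneg _))
    rw [(hk p hp).2] at this
    rw [sq, ← mul_assoc]
    exact this

theorem det_fderiv (hjac : ∀ x : T2, f.detD x = (f.deg : ℝ)) (z : V2) :
    LinearMap.det (fderiv ℝ f.F z : V2 →ₗ[ℝ] V2) = f.deg := by
  rw [← f.D_proj]; exact hjac _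

theorem step {C : ℝ} (hjac : ∀ x : T2, f.detD x = (f.deg : ℝ))
    (hC1 : 1 ≤ C) (hinv : ∀ p, ‖((f.DE p).symm : V2 →L[ℝ] V2)‖ ≤ C)
    (hC : ∀ p q, ‖fderiv ℝ f.F p - fderiv ℝ f.F q‖ ≤ C * ‖p - q‖)
    {S : Set T2} (hS : f.toFun ⁻¹' S ⊆ S) {z v w : V2} {r R r' R' : ℝ} (hv : ‖v‖ = 1)
    (hw : w = (f.DE z).symm v)
    (hrR : r ≤ R) (hR : R ≤ 1 / (8 * C ^ 3)) (h : St S (f.F z) v r R)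
    (hr' : r / (f.deg * ‖w‖) + 16 * C ^ 4 * R ^ 2 ≤ r') (hR0 : 0 ≤ R')
    (hR' : R' ≤ R * ‖w‖ - C * r - 16 * C ^ 4 * R ^ 2) : St S z (‖w‖⁻¹ • w) r' R' := by
  have hC0 : 0 < C := by linarith
  have hd : (0:ℝ) < f.deg := by exact_mod_cast f.deg_pos hjac
  obtain ⟨k, hkc, hk⟩ := f.local_inv hC1 hinv hC z
  obtain ⟨a, b, γ, hab, hc, h, ha, hb⟩ := h
  have hw0 : w ≠ 0 := by
    rw [hw]
    intro h0
    have : v = 0 := by simpa using h0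
    rw [this] at hv; simp at hv
  have hwp : 0 < ‖w‖ := norm_pos_iff.2 hw0
  have hv' : ‖‖w‖⁻¹ • w‖ = 1 := by
    rw [norm_smul, norm_inv, norm_norm, inv_mul_cancel₀ hwp.ne']
  have hinvL : ∀ u, ‖(f.DE z).symm u‖ ≤ C * ‖u‖ := by
    intro u
    refine (ContinuousLinearMap.le_opNorm ((f.DE z).symm : V2 →L[ℝ] V2) u).trans ?_
    gcongr; exact hinv z
  have hball : ∀ t ∈ Icc a b, γ t ∈ Metric.closedBall (f.F z) (1 / (4 * C ^ 3)) ∧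
      ‖γ t - f.F z‖ ≤ 2 * R := by
    intro t ht
    have h1 := norm_le_ip_om hv (γ t - f.F z)
    have h2 := h t ht
    have h3 : ‖γ t - f.F z‖ ≤ 2 * R := by linarith [h2.2.1, h2.2.2]
    refine ⟨?_, h3⟩
    rw [Metric.mem_closedBall, dist_eq_norm]
    have : 2 * (1 / (8 * C ^ 3)) = 1 / (4 * C ^ 3) := by field_simp; norm_num
    linarith
  -- error term
  have herr : ∀ t ∈ Icc a b, ∃ e : V2, ‖e‖ ≤ 16 * C ^ 4 * R ^ 2 ∧
      k (γ t) - z = (f.DE z).symm (γ t - f.F z) - e := by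
    intro t ht
    obtain ⟨hb1, hb2⟩ := hball t ht
    obtain ⟨h1, h2, h3⟩ := hk _ hb1
    refine ⟨(f.DE z).symm ((γ t - f.F z) - fderiv ℝ f.F z (k (γ t) - z)), ?_, ?_⟩
    · have h4 : ‖k (γ t) - z‖ ≤ 4 * C * R := by
        calc _ ≤ 2 * C * (2 * R) := h2.trans (by gcongr)
          _ = _ := by ring
      calc _ ≤ C * (C * ‖k (γ t) - z‖ ^ 2) := (hinvL _).trans (by gcongr)
        _ ≤ C * (C * (4 * C * R) ^ 2) := by gcongr
        _ = _ := by ring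
    · rw [← DE_coe]; simp
  refine St.mk' (γ := fun t => k (γ t)) hR0 hab (hkc.comp hc fun t ht => (hball t ht).1)
    (fun t ht => ⟨hS ?_, ?_⟩) ?_ ?_
  · rw [mem_preimage, f.toFun_proj, (hk _ (hball t ht).1).1]
    exact (h t ht).1
  · obtain ⟨e, he1, he2⟩ := herr t ht
    rw [he2, om_sub, om_smul_left]
    have h1 : om w ((f.DE z).symm (γ t - f.F z)) = om v (γ t - f.F z) / f.deg := by
      have h2 := om_det (fderiv ℝ f.F z) w ((f.DE z).symm (γ t - f.F z))
      rw [f.det_fderiv hjac, hw, ← DE_coe] at h2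
      simp only [ContinuousLinearEquiv.coe_coe, ContinuousLinearEquiv.apply_symm_apply] at h2
      rw [hw, h2]; field_simp
    rw [h1]
    have h2 := (h t ht).2.1
    have h3 := abs_om_le (‖w‖⁻¹ • w) e
    rw [hv', one_mul] at h3
    have h4 : |‖w‖⁻¹ * (om v (γ t - f.F z) / f.deg)| ≤ r / (f.deg * ‖w‖) := by
      rw [abs_mul, abs_div, abs_inv, abs_norm, abs_of_pos hd]
      calc _ ≤ ‖w‖⁻¹ * (r / f.deg) := by gcongr
        _ = _ := by field_simp
    have h5 := abs_sub (‖w‖⁻¹ * (om v (γ t - f.F z) / f.deg)) (om (‖w‖⁻¹ • w) e)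
    linarith
  all_goals
    have key : ∀ t ∈ Icc a b, |ip (‖w‖⁻¹ • w) (k (γ t) - z) - ip v (γ t - f.F z) * ‖w‖|
        ≤ C * r + 16 * C ^ 4 * R ^ 2 := by
      intro t ht
      obtain ⟨e, he1, he2⟩ := herr t ht
      set q := (γ t - f.F z) - ip v (γ t - f.F z) • v with hq
      have hq1 : ‖q‖ ≤ r := (norm_perp hv _).trans (h t ht).2.1
      have h1 : (f.DE z).symm (γ t - f.F z) = ip v (γ t - f.F z) • w + (f.DE z).symm q := by
        rw [hw, hq, map_sub (f.DE z).symm (γ t - f.F z) (ip v (γ t - f.F z) • v), map_smul]; abel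
      have h0 : ip (‖w‖⁻¹ • w) w = ‖w‖ := by
        rw [ip_smul_left, ip_self, sq, inv_mul_cancel_left₀ hwp.ne']
      rw [he2, h1, ip_sub, ip_add, ip_smul, h0]
      have h3 := abs_ip_le (‖w‖⁻¹ • w) e
      have h4 := abs_ip_le (‖w‖⁻¹ • w) ((f.DE z).symm q)
      rw [hv', one_mul] at h3 h4
      have h5 := hinvL q
      have h6 : C * ‖q‖ ≤ C * r := by gcongr
      rw [show ∀ x y u : ℝ, x + y - u - x = y - u from fun x y u => by ring]
      have h7 := abs_sub (ip (‖w‖⁻¹ • w) ((f.DE z).symm q)) (ip (‖w‖⁻¹ • w) e)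
      linarith
  · have := key a ⟨le_refl _, hab⟩
    rw [ha] at this
    have := (abs_le.1 this).2
    linarith
  · have := key b ⟨hab, le_refl _⟩
    rw [hb] at this
    have := (abs_le.1 this).1
    linarith

end TorusMap

namespace TorusMap

variable (f : TorusMap 2)

theorem D_cont : Continuous f.D := by
  have hq : IsQuotientMap proj := (proj_localHomeo.isOpenMap).isQuotientMap proj_cont proj_surj
  rw [hq.continuous_iff]
  have : f.D ∘ proj = fderiv ℝ f.F := funext f.D_proj
  rw [this]
  exact f.fderiv_contDiff.continuous

/-- The logarithmic expansion of the inverse branch. -/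
def Lg (y : T2) (v : V2) : ℝ := Real.log ‖Ring.inverse (f.D y) v‖

theorem inv_D_ne (y : T2) {v : V2} (hv : v ≠ 0) : Ring.inverse (f.D y) v ≠ 0 := by
  intro h
  have h1 : f.D y * Ring.inverse (f.D y) = 1 := Ring.mul_inverse_cancel _ (f.isUnit_D y)
  have h2 : (f.D y * Ring.inverse (f.D y)) v = v := by rw [h1]; rfl
  change f.D y (Ring.inverse (f.D y) v) = v at h2
  rw [h, map_zero] at h2
  exact hv h2.symm

theorem Lg_cont {y : T2} {v : V2} (hv : v ≠ 0) :
    ContinuousAt (fun z : T2 × V2 => f.Lg z.1 z.2) (y, v) := by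
  unfold Lg
  have h1 : ContinuousAt (fun y => Ring.inverse (f.D y)) y := by
    have := NormedRing.inverse_continuousAt (f.isUnit_D y).unit
    exact ContinuousAt.comp (g := Ring.inverse) this f.D_cont.continuousAt
  have h2 : ContinuousAt (fun z : T2 × V2 => Ring.inverse (f.D z.1)) (y, v) :=
    ContinuousAt.comp (g := fun y => Ring.inverse (f.D y)) (f := Prod.fst) h1 continuousAt_fst
  have h3 : ContinuousAt (fun z : T2 × V2 => Ring.inverse (f.D z.1) z.2) (y, v) :=
    h2.clm_apply continuousAt_snd
  exact h3.norm.log (norm_ne_zero_iff.2 (f.inv_D_ne y hv))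

/-- The fibre as a finset. -/
def fib (x : T2) : Finset T2 := (f.fiber_finite x).toFinset

theorem mem_fib {x y : T2} : y ∈ f.fib x ↔ f.toFun y = x := by
  simp [fib]

theorem fib_card (hjac : ∀ x : T2, f.detD x = (f.deg : ℝ)) (x : T2) : (f.fib x).card = f.deg := by
  rw [fib, ← Set.ncard_eq_toFinset_card _ (f.fiber_finite x), f.card_fiber hjac]

theorem fib_cont (hjac : ∀ x : T2, f.detD x = (f.deg : ℝ)) (x : T2) {m : ℝ} (hm : 0 < m)
    (h : ∀ v, ‖v‖ = 1 → m ≤ ∑ y ∈ f.fib x, f.Lg y v) :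
    ∀ᶠ x' in 𝓝 x, ∀ v, ‖v‖ = 1 → m / 2 ≤ ∑ y ∈ f.fib x', f.Lg y v := by
  have hd : (0:ℝ) < f.deg := by exact_mod_cast f.deg_pos hjac
  obtain ⟨U, hU, hdis⟩ := (f.fiber_finite x).t2_separation
  set ε := m / (2 * f.deg) with hε
  have hε0 : 0 < ε := by positivity
  have hW : ∀ y, ∀ᶠ y' in 𝓝 y, ∀ v ∈ Metric.sphere (0:V2) 1, f.Lg y v - ε < f.Lg y' v := by
    intro y
    refine (isCompact_sphere (0:V2) 1).eventually_forall_of_forall_eventually fun v hv => ?_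
    have hv0 : v ≠ 0 := by
      rintro rfl; simp at hv
    have h1 := f.Lg_cont (y := y) hv0
    have h2 : ContinuousAt (fun z : T2 × V2 => f.Lg y z.2 - ε) (y, v) := by
      refine ContinuousAt.sub ?_ continuousAt_const
      exact ContinuousAt.comp (f := fun z : T2 × V2 => (y, z.2)) (x := (y, v)) h1 (by fun_prop)
    exact h2.eventually_lt h1 (by simp only; linarith)
  have hall : ∀ᶠ x' in 𝓝 x, ∀ y ∈ f.fib x, ∃ y', f.toFun y' = x' ∧ y' ∈ U y ∧
      ∀ v ∈ Metric.sphere (0:V2) 1, f.Lg y v - ε < f.Lg y' v := by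
    rw [Filter.eventually_all_finset]
    intro y hy
    have h1 : {y' | y' ∈ U y ∧ ∀ v ∈ Metric.sphere (0:V2) 1, f.Lg y v - ε < f.Lg y' v} ∈ 𝓝 y :=
      Filter.inter_mem ((hU y).2.mem_nhds (hU y).1) (hW y)
    have h2 := f.toFun_localHomeo.isOpenMap.image_mem_nhds h1
    rw [f.mem_fib.1 hy] at h2
    filter_upwards [h2] with x' hx'
    obtain ⟨y', hy', h⟩ := hx'
    exact ⟨y', h, hy'⟩
  filter_upwards [hall] with x' hx' v hv
  choose! s hs using hx'
  have hinj : Set.InjOn s (f.fib x : Set T2) := by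
    intro a ha b hb hab
    by_contra hne
    have ha' : a ∈ f.toFun ⁻¹' {x} := f.mem_fib.1 ha
    have hb' : b ∈ f.toFun ⁻¹' {x} := f.mem_fib.1 hb
    have := hdis ha' hb' hne
    exact Set.disjoint_left.1 this (hs a ha).2.1 (hab ▸ (hs b hb).2.1)
  classical
  have himg : (f.fib x).image s = f.fib x' := by
    apply Finset.eq_of_subset_of_card_le
    · intro y hy
      obtain ⟨a, ha, rfl⟩ := Finset.mem_image.1 hy
      exact f.mem_fib.2 (hs a ha).1
    · rw [Finset.card_image_of_injOn hinj, f.fib_card hjac, f.fib_card hjac]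
  rw [← himg, Finset.sum_image hinj]
  have h1 : ∑ y ∈ f.fib x, (f.Lg y v - ε) ≤ ∑ y ∈ f.fib x, f.Lg (s y) v :=
    Finset.sum_le_sum fun y hy => ((hs y hy).2.2 v (by simpa using hv)).le
  rw [Finset.sum_sub_distrib, Finset.sum_const, f.fib_card hjac, nsmul_eq_mul] at h1
  have h2 := h v hv
  have h3 : f.deg * ε = m / 2 := by rw [hε]; field_simp
  linarith

theorem I_eq (x : T2) (v : V2) (n : ℕ) :
    f.I x v n = (((f.iter n).deg : ℝ))⁻¹ * ∑ y ∈ (f.iter n).fib x, (f.iter n).Lg y v := by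
  rw [iter_deg, I, Nat.cast_pow]
  congr 1
  rw [fib, ← finsum_mem_eq_finite_toFinset_sum]
  rfl

theorem pos_of_Isup {x : T2} (hI : 0 < f.Isup x) :
    ∃ n, 1 ≤ n ∧ ∃ c, 0 < c ∧ ∀ v, ‖v‖ = 1 → c ≤ f.I x v n := by
  by_contra hcon
  push Not at hcon
  have hle : ∀ n : ℕ, (⨅ v : Metric.sphere (0 : V2) 1, f.I x (v : V2) n) / n ≤ 0 := by
    intro n
    rcases Nat.eq_zero_or_pos n with rfl | hn
    · simp
    by_contra hpos
    push Not at hpos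
    have h1 : 0 < ⨅ v : Metric.sphere (0 : V2) 1, f.I x (v : V2) n := by
      have hn' : (0:ℝ) < n := by exact_mod_cast hn
      have := mul_pos hpos hn'
      rwa [div_mul_cancel₀ _ hn'.ne'] at this
    have hb : BddBelow (range fun v : Metric.sphere (0 : V2) 1 => f.I x (v : V2) n) := by
      by_contra hb
      rw [Real.iInf_of_not_bddBelow hb] at h1
      exact lt_irrefl _ h1
    obtain ⟨v, hv, hlt⟩ := hcon n hn _ h1
    have := ciInf_le hb ⟨v, by simpa using hv⟩
    exact absurd hlt (not_lt.2 this)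
  have : f.Isup x ≤ 0 := by
    unfold Isup
    rw [Filter.limsup_eq]
    by_cases hb : BddBelow {a : ℝ | ∀ᶠ n : ℕ in atTop,
        (⨅ v : Metric.sphere (0 : V2) 1, f.I x (v : V2) n) / n ≤ a}
    · exact csInf_le hb (Eventually.of_forall hle)
    · rw [Real.sInf_of_not_bddBelow hb]
  linarith

theorem unif_pos (hjac : ∀ x : T2, f.detD x = (f.deg : ℝ)) (hI : ∀ x : T2, 0 < f.Isup x) :
    ∃ N : ℕ, ∃ c : ℝ, 0 < c ∧ ∀ x, ∃ n, 1 ≤ n ∧ n ≤ N ∧ ∀ v, ‖v‖ = 1 →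
      c ≤ ((f.iter n).deg : ℝ)⁻¹ * ∑ y ∈ (f.iter n).fib x, (f.iter n).Lg y v := by
  have : ∃ N : ℕ, ∃ c : ℝ, 0 < c ∧ ∀ x ∈ (univ : Set T2), ∃ n, 1 ≤ n ∧ n ≤ N ∧ ∀ v, ‖v‖ = 1 →
      c ≤ ((f.iter n).deg : ℝ)⁻¹ * ∑ y ∈ (f.iter n).fib x, (f.iter n).Lg y v := by
    refine (isCompact_univ (X := T2)).induction_on (p := fun s => ∃ N : ℕ, ∃ c : ℝ, 0 < c ∧
      ∀ x ∈ s, ∃ n, 1 ≤ n ∧ n ≤ N ∧ ∀ v, ‖v‖ = 1 →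
      c ≤ ((f.iter n).deg : ℝ)⁻¹ * ∑ y ∈ (f.iter n).fib x, (f.iter n).Lg y v) ?_ ?_ ?_ ?_
    · exact ⟨0, 1, one_pos, fun x hx => absurd hx (notMem_empty x)⟩
    · rintro s t hst ⟨N, c, hc, h⟩
      exact ⟨N, c, hc, fun x hx => h x (hst hx)⟩
    · rintro s t ⟨N, c, hc, h⟩ ⟨N', c', hc', h'⟩
      refine ⟨max N N', min c c', lt_min hc hc', fun x hx => ?_⟩
      rcases hx with hx | hx
      · obtain ⟨n, h1, h2, h3⟩ := h x hx
        exact ⟨n, h1, h2.trans (le_max_left _ _), fun v hv => (min_le_left _ _).trans (h3 v hv)⟩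
      · obtain ⟨n, h1, h2, h3⟩ := h' x hx
        exact ⟨n, h1, h2.trans (le_max_right _ _), fun v hv => (min_le_right _ _).trans (h3 v hv)⟩
    · intro x _
      obtain ⟨n, hn, c, hc, h⟩ := f.pos_of_Isup (hI x)
      have hd : (0:ℝ) < (f.iter n).deg := by exact_mod_cast (f.iter n).deg_pos (f.iter_det hjac n)
      have h1 : ∀ v, ‖v‖ = 1 → (f.iter n).deg * c ≤ ∑ y ∈ (f.iter n).fib x, (f.iter n).Lg y v := by
        intro v hv
        have := h v hv
        rw [I_eq] at this
        rwa [← div_eq_inv_mul, le_div_iff₀' hd] at this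
      have h2 := (f.iter n).fib_cont (f.iter_det hjac n) x (mul_pos hd hc) h1
      refine ⟨_, mem_nhdsWithin_of_mem_nhds h2, n, c / 2, by positivity, fun x' hx' =>
        ⟨n, hn, le_refl _, fun v hv => ?_⟩⟩
      have := hx' v hv
      rw [← div_eq_inv_mul, le_div_iff₀' hd]
      linarith
  obtain ⟨N, c, hc, h⟩ := this
  exact ⟨N, c, hc, fun x => h x (mem_univ x)⟩

theorem Lg_proj (z v : V2) : f.Lg (proj z) v = Real.log ‖(f.DE z).symm v‖ := by
  unfold Lg
  rw [f.D_proj, ← DE_symm]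
  rfl

end TorusMap

/-- Good states at `x` with potential at most `φ`. -/
def Gd (S : Set T2) (η A α : ℝ) (x : T2) (φ : ℝ) : Prop :=
  ∃ y v r R, proj y = x ∧ ‖v‖ = 1 ∧ 0 < r ∧ 0 < R ∧ R ^ 2 ≤ η * r ∧ St S y v r R ∧
    A * r ^ α + (r / R) ^ (2 * α) ≤ φ

theorem avg_exp {ι : Type*} (s : Finset ι) {d : ℝ} (hd : (s.card : ℝ) = d) (l : ι → ℝ)
    {M c t : ℝ} (hM : ∀ i ∈ s, |l i| ≤ M) (hc : d * c ≤ ∑ i ∈ s, l i) (ht : 0 ≤ t) (htM : t * M ≤ 1) :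
    ∑ i ∈ s, Real.exp (-(t * l i)) ≤ d * (1 - t * c + t ^ 2 * M ^ 2) := by
  have h1 : ∀ i ∈ s, Real.exp (-(t * l i)) ≤ 1 - t * l i + t ^ 2 * M ^ 2 := by
    intro i hi
    have h2 : |-(t * l i)| ≤ 1 := by
      rw [abs_neg, abs_mul, abs_of_nonneg ht]
      exact (mul_le_mul_of_nonneg_left (hM i hi) ht).trans htM
    have h3 := (abs_le.1 (Real.abs_exp_sub_one_sub_id_le h2)).2
    have h4 : (-(t * l i)) ^ 2 ≤ t ^ 2 * M ^ 2 := by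
      rw [neg_sq, mul_pow]
      gcongr ?_ * ?_
      rw [← sq_abs]
      exact pow_le_pow_left₀ (abs_nonneg _) (hM i hi) 2
    linarith
  refine (Finset.sum_le_sum h1).trans ?_
  rw [Finset.sum_add_distrib, Finset.sum_sub_distrib, Finset.sum_const, Finset.sum_const,
    ← Finset.mul_sum, nsmul_eq_mul, nsmul_eq_mul, hd]
  nlinarith [mul_le_mul_of_nonneg_left hc ht]

theorem params {c C : ℝ} (hc : 0 < c) (hC : 1 ≤ C) :
    ∃ α lam κ μ : ℝ, 0 < α ∧ 0 < lam ∧ 1 < κ ∧ 0 < μ ∧ μ < 1 ∧ κ ^ (4 * α) * lam ≤ μ ∧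
      κ ^ α * lam ≤ μ ∧ 4 * α * C ≤ 1 ∧ 1 - α * c + α ^ 2 * C ^ 2 ≤ lam ∧
      1 - (4 * α) * c + (4 * α) ^ 2 * C ^ 2 ≤ lam := by
  have hC0 : 0 < C := by linarith
  set c' := min c 1 with hc'
  have hc'0 : 0 < c' := lt_min hc one_pos
  have hc'1 : c' ≤ 1 := min_le_right _ _
  have hc'c : c' ≤ c := min_le_left _ _
  set α := c' / (8 * C ^ 2) with hα
  have hα0 : 0 < α := by positivity
  have hαC : α * C ^ 2 = c' / 8 := by rw [hα]; field_simp
  have hαC1 : α * C ≤ α * C ^ 2 := by gcongr; nlinarith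
  have hα1 : α ≤ α * C := by nlinarith
  set lam := 1 - α * c' / 2 with hlam
  have hαc : 0 < α * c' := by positivity
  have hαc1 : α * c' ≤ 1 / 8 := by nlinarith
  have hl0 : 0 < lam := by rw [hlam]; linarith
  have hl1 : lam < 1 := by rw [hlam]; linarith
  set μ := (1 + lam) / 2 with hμ
  have hq : 1 < μ / lam := by rw [one_lt_div hl0]; linarith
  set κ := (μ / lam) ^ (1 / (4 * α)) with hκ
  have hκ1 : 1 < κ := Real.one_lt_rpow hq (by positivity)
  have hk4 : κ ^ (4 * α) = μ / lam := by
    rw [hκ, ← Real.rpow_mul (by positivity), one_div, inv_mul_cancel₀ (by positivity), Real.rpow_one]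
  have h1 : κ ^ (4 * α) * lam ≤ μ := by rw [hk4, div_mul_cancel₀ _ hl0.ne']
  refine ⟨α, lam, κ, μ, hα0, hl0, hκ1, by linarith, by linarith, h1, ?_, by linarith, ?_, ?_⟩
  · refine le_trans ?_ h1
    gcongr
    · exact hκ1.le
    · linarith
  · have : α * c' ≤ α * c := by gcongr
    have h3 : α ^ 2 * C ^ 2 = α * c' / 8 := by rw [sq α, mul_assoc, hαC]; ring
    rw [h3, hlam]; linarith
  · have : α * c' ≤ α * c := by gcongr
    have h3 : (4 * α) ^ 2 * C ^ 2 = 16 * (α * c' / 8) := by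
      rw [mul_pow, mul_assoc, sq α, mul_assoc α, hαC]; ring
    rw [h3, hlam]; linarith

/-- Change of the potential in one step. -/
theorem potential_step {α κ η A r R ω : ℝ} (hα : 0 < α) (hκ : 1 < κ) (hη : 0 < η) (hA : 0 < A)
    (hr : 0 < r) (hR : 0 < R) (hω : 0 < ω) :
    A * (κ * r / ω) ^ α + ((κ * r / ω) / min (R * ω / κ) (Real.sqrt (η * (κ * r / ω)))) ^ (2 * α)
      ≤ (A + η ^ (-α)) * κ ^ α * r ^ α * Real.exp (-(α * Real.log ω)) +
        κ ^ (4 * α) * (r / R) ^ (2 * α) * Real.exp (-((4 * α) * Real.log ω)) := by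
  have hκ0 : 0 < κ := by linarith
  set r' := κ * r / ω with hr'
  have hr'0 : 0 < r' := by positivity
  have e1 : ∀ t, Real.exp (-(t * Real.log ω)) = ω ^ (-t) := by
    intro t
    rw [Real.rpow_def_of_pos hω]; congr 1; ring
  rw [e1, e1]
  have hrα : r' ^ α = κ ^ α * r ^ α * ω ^ (-α) := by
    rw [hr', Real.div_rpow (by positivity) hω.le, Real.mul_rpow hκ0.le hr.le, Real.rpow_neg hω.le]
    rfl
  have h1 : (r' / min (R * ω / κ) (Real.sqrt (η * r'))) ^ (2 * α) ≤
      (r' / (R * ω / κ)) ^ (2 * α) + (r' / Real.sqrt (η * r')) ^ (2 * α) := by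
    have p1 : 0 ≤ (r' / (R * ω / κ)) ^ (2 * α) := by positivity
    have p2 : 0 ≤ (r' / Real.sqrt (η * r')) ^ (2 * α) := by positivity
    rcases min_choice (R * ω / κ) (Real.sqrt (η * r')) with h | h <;> rw [h] <;> linarith
  have h2 : (r' / (R * ω / κ)) ^ (2 * α) = κ ^ (4 * α) * (r / R) ^ (2 * α) * ω ^ (-(4 * α)) := by
    have : r' / (R * ω / κ) = κ ^ 2 * (r / R) * (ω ^ 2)⁻¹ := by rw [hr']; field_simp
    rw [this, Real.mul_rpow (by positivity) (by positivity), Real.mul_rpow (by positivity) (by positivity),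
      Real.inv_rpow (by positivity), ← Real.rpow_natCast, ← Real.rpow_natCast, ← Real.rpow_mul hκ0.le,
      ← Real.rpow_mul hω.le, ← Real.rpow_neg hω.le]
    congr 3 <;> push_cast <;> ring
  have h3 : (r' / Real.sqrt (η * r')) ^ (2 * α) = η ^ (-α) * r' ^ α := by
    have h4 : (r' / Real.sqrt (η * r')) ^ 2 = η⁻¹ * r' := by
      rw [div_pow, Real.sq_sqrt (by positivity)]; field_simp
    rw [Real.rpow_mul (by positivity), Real.rpow_two, h4, Real.mul_rpow (by positivity) hr'0.le,
      Real.inv_rpow hη.le, Real.rpow_neg hη.le]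
  rw [h2, h3] at h1
  calc _ ≤ A * r' ^ α + (κ ^ (4 * α) * (r / R) ^ (2 * α) * ω ^ (-(4 * α)) + η ^ (-α) * r' ^ α) := by
        linarith
    _ = _ := by rw [hrα]; ring

namespace TorusMap

variable (f : TorusMap 2)

theorem norm_w {C : ℝ} (hC : 1 ≤ C) (hD : ∀ p, ‖fderiv ℝ f.F p‖ ≤ C)
    (hinv : ∀ p, ‖((f.DE p).symm : V2 →L[ℝ] V2)‖ ≤ C) (z : V2) {v : V2} (hv : ‖v‖ = 1) :
    1 ≤ C * ‖(f.DE z).symm v‖ ∧ ‖(f.DE z).symm v‖ ≤ C := by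
  constructor
  · have h1 : fderiv ℝ f.F z ((f.DE z).symm v) = v := by rw [← DE_coe]; simp
    calc 1 = ‖fderiv ℝ f.F z ((f.DE z).symm v)‖ := by rw [h1, hv]
      _ ≤ _ := (ContinuousLinearMap.le_opNorm _ _).trans (by gcongr; exact hD z)
  · have := ContinuousLinearMap.le_opNorm ((f.DE z).symm : V2 →L[ℝ] V2) v
    rw [hv, mul_one] at this
    exact this.trans (hinv z)

theorem kstep {C κ η : ℝ} (hjac : ∀ x : T2, f.detD x = (f.deg : ℝ)) (hC1 : 1 ≤ C)
    (hD : ∀ p, ‖fderiv ℝ f.F p‖ ≤ C) (hinv : ∀ p, ‖((f.DE p).symm : V2 →L[ℝ] V2)‖ ≤ C)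
    (hC : ∀ p q, ‖fderiv ℝ f.F p - fderiv ℝ f.F q‖ ≤ C * ‖p - q‖)
    (hκ : 1 < κ) (hη : 0 < η) (hη1 : η ≤ 1) (hη2 : 17 * C ^ 5 * κ * η ≤ κ - 1) (hη3 : 8 * C ^ 3 * η ≤ 1)
    {S : Set T2} (hS : f.toFun ⁻¹' S ⊆ S) {z v w : V2} {r R : ℝ} (hv : ‖v‖ = 1)
    (hw : w = (f.DE z).symm v) (hr : 0 < r) (hR : 0 < R) (hrR : r ≤ η * R) (hRr : R ^ 2 ≤ η * r)
    (h : St S (f.F z) v r R) :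
    St S z (‖w‖⁻¹ • w) (κ * r / ‖w‖) (min (R * ‖w‖ / κ) (Real.sqrt (η * (κ * r / ‖w‖)))) := by
  have hC0 : 0 < C := by linarith
  have hκ0 : 0 < κ := by linarith
  obtain ⟨hw1, hw2⟩ := f.norm_w hC1 hD hinv z hv
  rw [← hw] at hw1 hw2
  have hwp : 0 < ‖w‖ := by
    by_contra hn
    have : ‖w‖ = 0 := le_antisymm (not_lt.1 hn) (norm_nonneg _)
    rw [this] at hw1; linarith
  have hd : (1:ℝ) ≤ f.deg := by exact_mod_cast f.deg_pos hjac
  have hrR' : r ≤ R := hrR.trans (by nlinarith)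
  have hRη : R ≤ η := by
    have h1 : R * R ≤ η * R := by nlinarith
    exact le_of_mul_le_mul_right h1 hR
  refine f.step hjac hC1 hinv hC hS hv hw hrR' ?_ h ?_ ?_ ?_
  · rw [le_div_iff₀ (by positivity)]
    have : R * (8 * C ^ 3) ≤ η * (8 * C ^ 3) := by gcongr
    linarith
  · have h1 : r / (f.deg * ‖w‖) ≤ r / ‖w‖ := by
      gcongr; nlinarith
    have h2 : 16 * C ^ 4 * R ^ 2 ≤ (κ - 1) * r / ‖w‖ := by
      rw [le_div_iff₀ hwp]
      have h3 : 16 * C ^ 4 * R ^ 2 * ‖w‖ ≤ 16 * C ^ 4 * (η * r) * C := by gcongr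
      have h4 : 16 * C ^ 4 * (η * r) * C ≤ (17 * C ^ 5 * κ * η) * r := by
        have : 16 * (C ^ 5 * η * r) ≤ 17 * κ * (C ^ 5 * η * r) := by gcongr; linarith
        linarith
      have h5 : (17 * C ^ 5 * κ * η) * r ≤ (κ - 1) * r := by gcongr
      linarith
    have h6 : κ * r / ‖w‖ = r / ‖w‖ + (κ - 1) * r / ‖w‖ := by ring
    linarith
  · positivity
  · refine (min_le_left _ _).trans ?_
    have h1 : C * r ≤ C ^ 4 * (η * R) := by
      have : C ≤ C ^ 4 := le_self_pow₀ hC1 (by norm_num)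
      gcongr
    have h2 : 16 * C ^ 4 * R ^ 2 ≤ 16 * (C ^ 4 * (η * R)) := by
      have : R ^ 2 ≤ η * R := by nlinarith
      nlinarith [pow_pos hC0 4]
    have h3 : 17 * (C ^ 4 * (η * R)) * κ ≤ (κ - 1) * (R * ‖w‖) := by
      calc 17 * (C ^ 4 * (η * R)) * κ ≤ 17 * (C ^ 4 * (η * R)) * κ * (C * ‖w‖) :=
            le_mul_of_one_le_right (by positivity) hw1
        _ = (17 * C ^ 5 * κ * η) * (R * ‖w‖) := by ring
        _ ≤ _ := by gcongr
    rw [div_le_iff₀ hκ0]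
    have h4 : (C * r + 16 * C ^ 4 * R ^ 2) * κ ≤ 17 * (C ^ 4 * (η * R)) * κ := by
      gcongr; linarith
    nlinarith

end TorusMap

namespace TorusMap

variable (f : TorusMap 2)

theorem iter_sub {S : Set T2} (hS : f.toFun ⁻¹' S ⊆ S) (n : ℕ) : (f.iter n).toFun ⁻¹' S ⊆ S := by
  change f.toFun^[n] ⁻¹' S ⊆ S
  induction n with
  | zero => exact subset_refl _
  | succ n ih =>
    intro x hx
    rw [mem_preimage, Function.iterate_succ_apply] at hx
    exact hS (ih hx)

theorem common_consts (N : ℕ) : ∃ C : ℝ, 1 ≤ C ∧ ∀ n ≤ N, (∀ p, ‖fderiv ℝ (f.iter n).F p‖ ≤ C) ∧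
    (∀ p, ‖(((f.iter n).DE p).symm : V2 →L[ℝ] V2)‖ ≤ C) ∧
    (∀ p q, ‖fderiv ℝ (f.iter n).F p - fderiv ℝ (f.iter n).F q‖ ≤ C * ‖p - q‖) := by
  have h := fun n => (f.iter n).exists_consts
  choose c hc1 hc using h
  have hle : ∀ n ≤ N, c n ≤ ∑ i ∈ Finset.range (N + 1), c i := fun n hn =>
    Finset.single_le_sum (f := c) (fun i _ => by linarith [hc1 i]) (Finset.mem_range.2 (by omega))
  refine ⟨∑ i ∈ Finset.range (N + 1), c i, (hc1 0).trans (hle 0 (Nat.zero_le _)), fun n hn => ?_⟩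
  obtain ⟨h1, h2, h3⟩ := hc n
  refine ⟨fun p => (h1 p).trans (hle n hn), fun p => (h2 p).trans (hle n hn), fun p q =>
    (h3 p q).trans ?_⟩
  gcongr
  exact hle n hn

theorem Lg_le {C : ℝ} (hC : 1 ≤ C) (hD : ∀ p, ‖fderiv ℝ f.F p‖ ≤ C)
    (hinv : ∀ p, ‖((f.DE p).symm : V2 →L[ℝ] V2)‖ ≤ C) (x : T2) {v : V2} (hv : ‖v‖ = 1) :
    |f.Lg x v| ≤ C := by
  obtain ⟨z, rfl⟩ := proj_surj x
  rw [Lg_proj]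
  obtain ⟨h1, h2⟩ := f.norm_w hC hD hinv z hv
  have hC0 : 0 < C := by linarith
  have hp : 0 < ‖(f.DE z).symm v‖ := by
    by_contra hn
    have : ‖(f.DE z).symm v‖ = 0 := le_antisymm (not_lt.1 hn) (norm_nonneg _)
    rw [this] at h1; linarith
  have h3 := Real.log_le_sub_one_of_pos hC0
  have h4 := Real.log_le_log hp h2
  have h5 := Real.log_nonneg h1
  rw [Real.log_mul hC0.ne' hp.ne'] at h5
  rw [abs_le]
  constructor <;> linarith

theorem fib_step {C κ η α A : ℝ} (hjac : ∀ x : T2, f.detD x = (f.deg : ℝ)) (hC1 : 1 ≤ C)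
    (hD : ∀ p, ‖fderiv ℝ f.F p‖ ≤ C) (hinv : ∀ p, ‖((f.DE p).symm : V2 →L[ℝ] V2)‖ ≤ C)
    (hC : ∀ p q, ‖fderiv ℝ f.F p - fderiv ℝ f.F q‖ ≤ C * ‖p - q‖)
    (hκ : 1 < κ) (hη : 0 < η) (hη1 : η ≤ 1) (hη2 : 17 * C ^ 5 * κ * η ≤ κ - 1) (hη3 : 8 * C ^ 3 * η ≤ 1)
    (hα : 0 < α) (hA : 0 < A)
    {S : Set T2} (hS : f.toFun ⁻¹' S ⊆ S) {x : T2} {φ : ℝ} (hφ : φ < η ^ (2 * α))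
    (h : Gd S η A α x φ) : ∃ v r R, ‖v‖ = 1 ∧ 0 < r ∧ 0 < R ∧ A * r ^ α + (r / R) ^ (2 * α) ≤ φ ∧
      ∀ y ∈ f.fib x, Gd S η A α y ((A + η ^ (-α)) * κ ^ α * r ^ α * Real.exp (-(α * f.Lg y v)) +
        κ ^ (4 * α) * (r / R) ^ (2 * α) * Real.exp (-((4 * α) * f.Lg y v))) := by
  obtain ⟨y, v, r, R, rfl, hv, hr, hR, hRr, hst, hpot⟩ := h
  refine ⟨v, r, R, hv, hr, hR, hpot, fun x hx => ?_⟩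
  obtain ⟨z, rfl⟩ := proj_surj x
  have hx' := f.mem_fib.1 hx
  rw [f.toFun_proj] at hx'
  obtain ⟨m, hm⟩ := (proj_eq_iff _ _).1 hx'.symm
  have hst' := hst.translate m
  rw [← hm] at hst'
  have hκ0 : 0 < κ := by linarith
  have hrR : r ≤ η * R := by
    have h1 : (r / R) ^ (2 * α) < η ^ (2 * α) := by
      have : 0 ≤ A * r ^ α := by positivity
      linarith
    have h2 := (Real.rpow_lt_rpow_iff (by positivity) hη.le (by positivity)).1 h1
    rw [div_lt_iff₀ hR] at h2
    exact h2.le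
  set w := (f.DE z).symm v with hw
  have hstep := f.kstep hjac hC1 hD hinv hC hκ hη hη1 hη2 hη3 hS hv hw hr hR hrR hRr hst'
  obtain ⟨h1, h2⟩ := f.norm_w hC1 hD hinv z hv
  rw [← hw] at h1
  have hp : 0 < ‖w‖ := by
    by_contra hn
    have : ‖w‖ = 0 := le_antisymm (not_lt.1 hn) (norm_nonneg _)
    rw [this] at h1; linarith
  refine ⟨z, _, _, _, rfl, ?_, ?_, ?_, ?_, hstep, ?_⟩
  · rw [norm_smul, norm_inv, norm_norm, inv_mul_cancel₀ hp.ne']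
  · positivity
  · apply lt_min <;> positivity
  · calc _ ≤ (Real.sqrt (η * (κ * r / ‖w‖))) ^ 2 := by
          gcongr
          exact min_le_right _ _
      _ = _ := Real.sq_sqrt (by positivity)
  · rw [Lg_proj]
    exact potential_step hα hκ hη hA hr hR hp

theorem engine (hjac : ∀ x : T2, f.detD x = (f.deg : ℝ)) (hI : ∀ x : T2, 0 < f.Isup x) :
    ∃ (N : ℕ) (μ η A α Φ0 K : ℝ), 0 < μ ∧ μ < 1 ∧ 0 < η ∧ η ≤ 1 ∧ 0 < A ∧ 0 < α ∧ 0 < Φ0 ∧ 0 < K ∧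
      ∀ S : Set T2, f.toFun ⁻¹' S ⊆ S →
      (∀ x, ∃ n, 1 ≤ n ∧ n ≤ N ∧ ∀ φ < Φ0, Gd S η A α x φ → ∃ ψ : T2 → ℝ,
        (∀ y ∈ (f.iter n).fib x, Gd S η A α y (ψ y)) ∧
        ∑ y ∈ (f.iter n).fib x, ψ y ≤ μ * (f.iter n).deg * φ) ∧
      (∀ n ≤ N, ∀ x, ∀ φ < Φ0, Gd S η A α x φ → ∀ y ∈ (f.iter n).fib x, Gd S η A α y (K * φ)) := by
  obtain ⟨N, c, hc, hunif⟩ := f.unif_pos hjac hI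
  obtain ⟨C, hC1, hCC⟩ := f.common_consts N
  obtain ⟨α, lam, κ, μ, hα, hlam, hκ, hμ0, hμ1, hk4, hk1, hαC, hl1, hl4⟩ := params hc hC1
  have hC0 : 0 < C := by linarith
  have hκ0 : 0 < κ := by linarith
  set η := min (min 1 ((κ - 1) / (17 * C ^ 5 * κ))) (1 / (8 * C ^ 3)) with hηdef
  have hη : 0 < η := by
    apply lt_min (lt_min one_pos _) (by positivity)
    exact div_pos (by linarith) (by positivity)
  have hη1 : η ≤ 1 := (min_le_left _ _).trans (min_le_left _ _)
  have hη2 : 17 * C ^ 5 * κ * η ≤ κ - 1 := by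
    have : η ≤ (κ - 1) / (17 * C ^ 5 * κ) := (min_le_left _ _).trans (min_le_right _ _)
    rw [le_div_iff₀ (by positivity)] at this
    linarith
  have hη3 : 8 * C ^ 3 * η ≤ 1 := by
    have : η ≤ 1 / (8 * C ^ 3) := min_le_right _ _
    rw [le_div_iff₀ (by positivity)] at this
    linarith
  set E := η ^ (-α) with hE
  have hE0 : 0 < E := by positivity
  set A := 2 * μ * E / (1 - μ) with hA
  have h1μ : 0 < 1 - μ := by linarith
  have hA0 : 0 < A := by positivity
  have hAe : A * (1 - μ) = 2 * μ * E := by rw [hA]; field_simp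
  set K := (A + E) * κ ^ α * Real.exp 1 / A + κ ^ (4 * α) * Real.exp 1 with hK
  have hK0 : 0 < K := by positivity
  refine ⟨N, (1 + μ) / 2, η, A, α, η ^ (2 * α), K, by linarith, by linarith, hη, hη1, hA0, hα,
    by positivity, hK0, fun S hS => ⟨fun x => ?_, fun n hn x φ hφ hG y hy => ?_⟩⟩
  · obtain ⟨n, hn1, hn2, hn⟩ := hunif x
    obtain ⟨hD, hinv, hL⟩ := hCC n hn2
    refine ⟨n, hn1, hn2, fun φ hφ hG => ?_⟩
    obtain ⟨v, r, R, hv, hr, hR, hpot, hfib⟩ := (f.iter n).fib_step (f.iter_det hjac n) hC1 hD hinv hL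
      hκ hη hη1 hη2 hη3 hα hA0 (f.iter_sub hS n) hφ hG
    refine ⟨_, hfib, ?_⟩
    have hd : (0:ℝ) < (f.iter n).deg := by exact_mod_cast (f.iter n).deg_pos (f.iter_det hjac n)
    have hsum : ((f.iter n).deg : ℝ) * c ≤ ∑ y ∈ (f.iter n).fib x, (f.iter n).Lg y v := by
      have := hn v hv
      rwa [← div_eq_inv_mul, le_div_iff₀' hd] at this
    have hcard : (((f.iter n).fib x).card : ℝ) = (f.iter n).deg := by
      rw [(f.iter n).fib_card (f.iter_det hjac n)]
    have hLg : ∀ y ∈ (f.iter n).fib x, |(f.iter n).Lg y v| ≤ C := fun y _ =>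
      (f.iter n).Lg_le hC1 hD hinv y hv
    have a1 := avg_exp _ hcard _ hLg hsum hα.le (by nlinarith)
    have a4 := avg_exp _ hcard _ hLg hsum (t := 4 * α) (by positivity) hαC
    rw [Finset.sum_add_distrib, ← Finset.mul_sum, ← Finset.mul_sum]
    set d : ℝ := ((f.iter n).deg : ℝ) with hddef
    have b1 : ∑ y ∈ (f.iter n).fib x, Real.exp (-(α * (f.iter n).Lg y v)) ≤ d * lam :=
      a1.trans (by gcongr)
    have b4 : ∑ y ∈ (f.iter n).fib x, Real.exp (-(4 * α * (f.iter n).Lg y v)) ≤ d * lam :=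
      a4.trans (by gcongr)
    have hrα : 0 < r ^ α := by positivity
    have hrR : 0 < (r / R) ^ (2 * α) := by positivity
    calc _ ≤ (A + E) * κ ^ α * r ^ α * (d * lam) + κ ^ (4 * α) * (r / R) ^ (2 * α) * (d * lam) := by
          gcongr
      _ = d * ((A + E) * (κ ^ α * lam) * r ^ α + (κ ^ (4 * α) * lam) * (r / R) ^ (2 * α)) := by ring
      _ ≤ d * ((A + E) * μ * r ^ α + μ * (r / R) ^ (2 * α)) := by gcongr
      _ ≤ d * ((1 + μ) / 2 * (A * r ^ α) + (1 + μ) / 2 * (r / R) ^ (2 * α)) := by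
          have e1 : (A + E) * μ = (1 + μ) / 2 * A := by linarith
          rw [e1, mul_assoc]
          gcongr
          linarith
      _ = (1 + μ) / 2 * d * (A * r ^ α + (r / R) ^ (2 * α)) := by ring
      _ ≤ _ := by gcongr
  · obtain ⟨hD, hinv, hL⟩ := hCC n hn
    obtain ⟨v, r, R, hv, hr, hR, hpot, hfib⟩ := (f.iter n).fib_step (f.iter_det hjac n) hC1 hD hinv hL
      hκ hη hη1 hη2 hη3 hα hA0 (f.iter_sub hS n) hφ hG
    have hg := hfib y hy
    have hLg := (abs_le.1 ((f.iter n).Lg_le hC1 hD hinv y hv)).1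
    have h1 : Real.exp (-(α * (f.iter n).Lg y v)) ≤ Real.exp 1 := by
      apply Real.exp_le_exp.2; nlinarith
    have h4 : Real.exp (-(4 * α * (f.iter n).Lg y v)) ≤ Real.exp 1 := by
      apply Real.exp_le_exp.2; nlinarith
    obtain ⟨y', v', r', R', q1, q2, q3, q4, q5, q6, q7⟩ := hg
    refine ⟨y', v', r', R', q1, q2, q3, q4, q5, q6, q7.trans ?_⟩
    have p1 : (A + E) * κ ^ α * r ^ α * Real.exp (-(α * (f.iter n).Lg y v)) ≤
        ((A + E) * κ ^ α * Real.exp 1 / A) * (A * r ^ α) := by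
      have : ((A + E) * κ ^ α * Real.exp 1 / A) * (A * r ^ α) = (A + E) * κ ^ α * r ^ α * Real.exp 1 := by
        field_simp
      rw [this]
      gcongr
    have p4 : κ ^ (4 * α) * (r / R) ^ (2 * α) * Real.exp (-(4 * α * (f.iter n).Lg y v)) ≤
        (κ ^ (4 * α) * Real.exp 1) * (r / R) ^ (2 * α) := by
      rw [mul_right_comm]
      gcongr
    have hrα : 0 < r ^ α := by positivity
    have hrR : 0 < (r / R) ^ (2 * α) := by positivity
    have k1 : ((A + E) * κ ^ α * Real.exp 1 / A) * (A * r ^ α) ≤ K * (A * r ^ α) := by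
      gcongr
      rw [hK]
      have : 0 < κ ^ (4 * α) * Real.exp 1 := by positivity
      linarith
    have k4 : (κ ^ (4 * α) * Real.exp 1) * (r / R) ^ (2 * α) ≤ K * (r / R) ^ (2 * α) := by
      gcongr
      rw [hK]
      have : 0 < (A + E) * κ ^ α * Real.exp 1 / A := by positivity
      linarith
    have k5 : K * (A * r ^ α + (r / R) ^ (2 * α)) ≤ K * φ := by gcongr
    linarith

end TorusMap

theorem dist_proj_le (p q : V2) : dist (proj p) (proj q) ≤ ‖p - q‖ := by
  rw [Prod.dist_eq]
  have h : ∀ i, dist ((p i : ℝ) : AddCircle (1:ℝ)) ((q i : ℝ) : AddCircle (1:ℝ)) ≤ ‖p - q‖ := by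
    intro i
    rw [dist_eq_norm, ← AddCircle.coe_sub]
    refine (QuotientAddGroup.norm_mk_le_norm).trans ?_
    exact PiLp.norm_apply_le (p - q) i
  exact max_le (h 0) (h 1)

theorem Gd_near {η A α δ : ℝ} (hA : 0 < A) (hα : 0 < α) (hδ : 0 < δ) :
    ∃ φδ, 0 < φδ ∧ ∀ (S : Set T2) (x : T2) (φ : ℝ), φ ≤ φδ → Gd S η A α x φ →
      x ∈ Metric.thickening δ S := by
  refine ⟨A * (δ / 2) ^ α, by positivity, ?_⟩
  rintro S x φ hφ ⟨y, v, r, R, rfl, hv, hr, hR, hRr, hst, hpot⟩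
  obtain ⟨p, hp, hpy⟩ := hst.near hv hR.le
  have h1 : A * r ^ α ≤ A * (δ / 2) ^ α := by
    have : 0 ≤ (r / R) ^ (2 * α) := by positivity
    linarith
  have h2 : r ≤ δ / 2 := (Real.rpow_le_rpow_iff hr.le (by positivity) hα).1
    (le_of_mul_le_mul_left h1 hA)
  rw [Metric.mem_thickening_iff]
  refine ⟨proj p, hp, ?_⟩
  rw [dist_comm]
  have := dist_proj_le p y
  linarith

theorem Gd_pos {S : Set T2} {η A α : ℝ} (hA : 0 < A) {x : T2} {φ : ℝ} (h : Gd S η A α x φ) :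
    0 < φ := by
  obtain ⟨y, v, r, R, rfl, hv, hr, hR, hRr, hst, hpot⟩ := h
  have : 0 < A * r ^ α := by positivity
  have : 0 ≤ (r / R) ^ (2 * α) := by positivity
  linarith

open Classical in
/-- Number of preimages of order `n` lying in `O`. -/
def TorusMap.cnt (f : TorusMap 2) (O : Set T2) (n : ℕ) (x : T2) : ℕ :=
  (((f.iter n).fib x).filter (· ∈ O)).card

namespace TorusMap

variable (f : TorusMap 2)

theorem cnt_add (O : Set T2) (n m : ℕ) (x : T2) :
    f.cnt O (n + m) x = ∑ y ∈ (f.iter n).fib x, f.cnt O m y := by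
  classical
  unfold cnt
  rw [Finset.card_eq_sum_card_fiberwise (f := (f.iter m).toFun) (t := (f.iter n).fib x)]
  · refine Finset.sum_congr rfl fun y hy => ?_
    congr 1
    ext z
    simp only [Finset.mem_filter, mem_fib] at hy ⊢
    change (f.toFun^[n + m] z = x ∧ z ∈ O) ∧ f.toFun^[m] z = y ↔ f.toFun^[m] z = y ∧ z ∈ O
    change f.toFun^[n] y = x at hy
    rw [Function.iterate_add_apply]
    constructor
    · rintro ⟨⟨-, h⟩, h'⟩; exact ⟨h', h⟩
    · rintro ⟨h', h⟩; rw [h']; exact ⟨⟨hy, h⟩, rfl⟩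
  · intro z hz
    simp only [Finset.coe_filter, mem_fib, mem_ofPred_eq] at hz
    simp only [Finset.mem_coe, mem_fib]
    have := hz.1
    change f.toFun^[n + m] z = x at this
    rw [Function.iterate_add_apply] at this
    exact this

theorem count_bound (hjac : ∀ x : T2, f.detD x = (f.deg : ℝ)) {N : ℕ} {μ Φ0 K l φδ : ℝ}
    {G : T2 → ℝ → Prop} {O : Set T2} (hG : ∀ x φ, G x φ → 0 < φ) (hμ0 : 0 < μ) (hμ1 : μ < 1)
    (hΦ0 : 0 < Φ0) (hK : 0 < K) (hl0 : 0 < l) (hl1 : l ≤ 1) (hlμ : μ ≤ l ^ N) (hφδ : 0 < φδ)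
    (ha : ∀ x, ∃ n, 1 ≤ n ∧ n ≤ N ∧ ∀ φ < Φ0, G x φ → ∃ ψ : T2 → ℝ,
        (∀ y ∈ (f.iter n).fib x, G y (ψ y)) ∧
        ∑ y ∈ (f.iter n).fib x, ψ y ≤ μ * (f.iter n).deg * φ)
    (hb : ∀ n ≤ N, ∀ x, ∀ φ < Φ0, G x φ → ∀ y ∈ (f.iter n).fib x, G y (K * φ))
    (hc : ∀ x, ∀ φ ≤ φδ, G x φ → x ∈ O) (n : ℕ) :
    ∀ x φ, G x φ → (f.deg : ℝ) ^ n * (1 - φ / Φ0 - l ^ n * φ / (l ^ N * φδ / K)) ≤ f.cnt O n x := by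
  have hd : (0:ℝ) < f.deg := by exact_mod_cast f.deg_pos hjac
  set Φd := l ^ N * φδ / K with hΦd
  have hΦd0 : 0 < Φd := by positivity
  induction n using Nat.strong_induction_on with
  | _ n ih =>
  intro x φ hx
  have hφ := hG x φ hx
  by_cases h0 : Φ0 ≤ φ
  · have h1 : 1 ≤ φ / Φ0 := by rwa [one_le_div hΦ0]
    have h2 : 0 ≤ l ^ n * φ / Φd := by positivity
    have h3 : (f.deg : ℝ) ^ n * (1 - φ / Φ0 - l ^ n * φ / Φd) ≤ 0 :=
      mul_nonpos_of_nonneg_of_nonpos (by positivity) (by linarith)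
    exact h3.trans (by positivity)
  push Not at h0
  by_cases hn : n ≤ N
  · by_cases h1 : Φd ≤ l ^ n * φ
    · have h1 : 1 ≤ l ^ n * φ / Φd := by rwa [one_le_div hΦd0]
      have h2 : 0 ≤ φ / Φ0 := by positivity
      have h3 : (f.deg : ℝ) ^ n * (1 - φ / Φ0 - l ^ n * φ / Φd) ≤ 0 :=
        mul_nonpos_of_nonneg_of_nonpos (by positivity) (by linarith)
      exact h3.trans (by positivity)
    push Not at h1
    have h2 : K * φ ≤ φδ := by
      have h3 : l ^ N * φ ≤ l ^ n * φ := by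
        gcongr ?_ * _
        exact pow_le_pow_of_le_one hl0.le hl1 hn
      have h4 : l ^ N * φ < l ^ N * φδ / K := h3.trans_lt h1
      rw [lt_div_iff₀ hK] at h4
      have h5 : l ^ N * (K * φ) ≤ l ^ N * φδ := by linarith
      exact le_of_mul_le_mul_left h5 (by positivity)
    have h3 : f.cnt O n x = f.deg ^ n := by
      classical
      unfold cnt
      rw [Finset.filter_true_of_mem (fun y hy => hc y _ h2 (hb n hn x φ h0 hx y hy)),
        (f.iter n).fib_card (f.iter_det hjac n), iter_deg]
    rw [h3, Nat.cast_pow]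
    have h4 : 0 ≤ φ / Φ0 := by positivity
    have h5 : 0 ≤ l ^ n * φ / Φd := by positivity
    exact mul_le_of_le_one_right (by positivity) (by linarith)
  · push Not at hn
    obtain ⟨n0, h1, h2, hstep⟩ := ha x
    obtain ⟨ψ, hψ, hsum⟩ := hstep φ h0 hx
    obtain ⟨m, rfl⟩ : ∃ m, n = n0 + m := ⟨n - n0, by omega⟩
    rw [cnt_add, Nat.cast_sum]
    refine le_trans ?_ (Finset.sum_le_sum fun y hy => ih m (by omega) y (ψ y) (hψ y hy))
    have e1 : ∀ y, (f.deg : ℝ) ^ m * (1 - ψ y / Φ0 - l ^ m * ψ y / Φd) =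
        (f.deg : ℝ) ^ m - ((f.deg : ℝ) ^ m * (1 / Φ0 + l ^ m / Φd)) * ψ y := fun y => by ring
    simp only [e1]
    rw [Finset.sum_sub_distrib, Finset.sum_const, ← Finset.mul_sum,
      (f.iter n0).fib_card (f.iter_det hjac n0), nsmul_eq_mul]
    rw [iter_deg, Nat.cast_pow] at hsum ⊢
    have h5 : ((f.deg : ℝ) ^ m * (1 / Φ0 + l ^ m / Φd)) * ∑ y ∈ (f.iter n0).fib x, ψ y ≤
        ((f.deg : ℝ) ^ m * (1 / Φ0 + l ^ m / Φd)) * (μ * (f.deg : ℝ) ^ n0 * φ) := by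
      gcongr
    have h6 : ((f.deg : ℝ) ^ m * (1 / Φ0 + l ^ m / Φd)) * (μ * (f.deg : ℝ) ^ n0 * φ) =
        (f.deg : ℝ) ^ (n0 + m) * (μ * φ / Φ0 + (μ * l ^ m) * φ / Φd) := by
      rw [pow_add]; ring
    have h7 : (f.deg : ℝ) ^ (n0 + m) * (μ * φ / Φ0 + (μ * l ^ m) * φ / Φd) ≤
        (f.deg : ℝ) ^ (n0 + m) * (φ / Φ0 + l ^ (n0 + m) * φ / Φd) := by
      have h8 : μ * φ ≤ φ := by nlinarith
      have h9 : μ * l ^ m ≤ l ^ (n0 + m) := by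
        rw [pow_add]
        gcongr
        exact hlμ.trans (pow_le_pow_of_le_one hl0.le hl1 h2)
      gcongr
    have h10 : (f.deg : ℝ) ^ (n0 + m) * (1 - φ / Φ0 - l ^ (n0 + m) * φ / Φd) =
      (f.deg : ℝ) ^ n0 * (f.deg : ℝ) ^ m - (f.deg : ℝ) ^ (n0 + m) * (φ / Φ0 + l ^ (n0 + m) * φ / Φd) := by
      rw [pow_add]; ring
    linarith

theorem vol_closure_ge (hjac : ∀ x : T2, f.detD x = (f.deg : ℝ)) {N : ℕ} {μ η A α Φ0 K : ℝ}
    (hμ0 : 0 < μ) (hμ1 : μ < 1) (hA : 0 < A) (hα : 0 < α) (hΦ0 : 0 < Φ0) (hK : 0 < K) {S : Set T2}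
    (ha : ∀ x, ∃ n, 1 ≤ n ∧ n ≤ N ∧ ∀ φ < Φ0, Gd S η A α x φ → ∃ ψ : T2 → ℝ,
        (∀ y ∈ (f.iter n).fib x, Gd S η A α y (ψ y)) ∧
        ∑ y ∈ (f.iter n).fib x, ψ y ≤ μ * (f.iter n).deg * φ)
    (hb : ∀ n ≤ N, ∀ x, ∀ φ < Φ0, Gd S η A α x φ → ∀ y ∈ (f.iter n).fib x, Gd S η A α y (K * φ))
    {B : Set T2} (hB : IsOpen B) (hBG : ∀ x ∈ B, Gd S η A α x (Φ0 / 4)) :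
    volume B ≤ 2 * volume (closure S) := by
  have hd : (0:ℝ) < f.deg := by exact_mod_cast f.deg_pos hjac
  have hN : (0:ℝ) < (N:ℝ) + 1 := by positivity
  set l := μ ^ (1 / ((N:ℝ) + 1)) with hl
  have hl0 : 0 < l := by positivity
  have hl1 : l < 1 := Real.rpow_lt_one hμ0.le hμ1 (by positivity)
  have hlμ : μ ≤ l ^ N := by
    have h1 : l ^ (N + 1) = μ := by
      rw [← Real.rpow_natCast, hl, ← Real.rpow_mul hμ0.le]
      push_cast
      rw [one_div, inv_mul_cancel₀ hN.ne', Real.rpow_one]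
    rw [← h1]
    exact pow_le_pow_of_le_one hl0.le hl1.le (by omega)
  have hthick : ∀ δ > 0, volume B ≤ 2 * volume (Metric.thickening δ S) := by
    intro δ hδ
    obtain ⟨φδ, hφδ, hnear⟩ := Gd_near (η := η) hA hα hδ
    have key := f.count_bound hjac (G := Gd S η A α) (O := Metric.thickening δ S)
      (fun x φ h => Gd_pos hA h) hμ0 hμ1 hΦ0 hK hl0 hl1.le hlμ hφδ ha hb
      (fun x φ hφ h => hnear S x φ hφ h)
    have hlim : Tendsto (fun n : ℕ => l ^ n * (Φ0 / 4) / (l ^ N * φδ / K)) atTop (𝓝 0) := by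
      have := ((tendsto_pow_atTop_nhds_zero_of_lt_one hl0.le hl1).mul_const (Φ0 / 4)).div_const
        (l ^ N * φδ / K)
      simpa using this
    obtain ⟨n, hn⟩ := ((tendsto_order.1 hlim).2 (1 / 4) (by norm_num)).exists
    refine (f.iter n).vol_ge (f.iter_det hjac n) Metric.isOpen_thickening.measurableSet
      hB.measurableSet fun x hx => ?_
    have h1 := key n x _ (hBG x hx)
    have h2 : (((f.iter n).toFun ⁻¹' {x} ∩ Metric.thickening δ S).ncard : ℝ)
        = f.cnt (Metric.thickening δ S) n x := by
      classical
      unfold cnt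
      rw [← Set.ncard_coe_finset]
      congr 2
      ext y
      simp [mem_fib]
    rw [h2, iter_deg, Nat.cast_pow]
    refine le_trans ?_ h1
    rw [div_eq_mul_inv]
    gcongr
    have : Φ0 / 4 / Φ0 = 1 / 4 := by field_simp
    rw [this]
    linarith
  have ht := tendsto_measure_thickening (μ := (volume : Measure T2)) (s := S)
    ⟨1, one_pos, measure_ne_top _ _⟩
  have ht2 := ENNReal.Tendsto.const_mul (a := 2) ht (Or.inr (by simp))
  refine ge_of_tendsto ht2 ?_
  filter_upwards [self_mem_nhdsWithin] with δ hδ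
  exact hthick δ hδ

theorem dense_of_vol_pos (hjac : ∀ x : T2, f.detD x = (f.deg : ℝ))
    (herg : ∀ A : Set T2, MeasurableSet A → f.toFun ⁻¹' A = A →
      (volume : Measure T2) A = 0 ∨ (volume : Measure T2) A = 1)
    {S : Set T2} (hS : f.toFun ⁻¹' S ⊆ S) (hpos : 0 < volume (closure S)) : Dense S := by
  set A := closure S with hA
  have hAsub : f.toFun ⁻¹' A ⊆ A :=
    (f.toFun_localHomeo.isOpenMap.preimage_closure_subset_closure_preimage).trans (closure_mono hS)
  have hAm : MeasurableSet A := isClosed_closure.measurableSet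
  have hcont : ∀ n, Measurable (f.toFun^[n]) := fun n => (f.toFun_cont.iterate n).measurable
  have hanti : Antitone fun n : ℕ => f.toFun^[n] ⁻¹' A := by
    refine antitone_nat_of_succ_le fun n x hx => ?_
    rw [mem_preimage, Function.iterate_succ_apply'] at hx
    exact hAsub hx
  set B := ⋂ n : ℕ, f.toFun^[n] ⁻¹' A with hB
  have hBm : MeasurableSet B := MeasurableSet.iInter fun n => hcont n hAm
  have hBinv : f.toFun ⁻¹' B = B := by
    ext x
    simp only [hB, preimage_iInter, mem_iInter, mem_preimage]
    constructor
    · intro h n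
      have h1 := h n
      rw [← Function.iterate_succ_apply] at h1
      exact hanti (Nat.le_succ n) h1
    · intro h n
      rw [← Function.iterate_succ_apply]
      exact h (n + 1)
  have hvol : volume B = volume A := by
    have ht := tendsto_measure_iInter_atTop (μ := (volume : Measure T2))
      (fun n => (hcont n hAm).nullMeasurableSet) hanti ⟨0, measure_ne_top _ _⟩
    have hc : ∀ n, volume (f.toFun^[n] ⁻¹' A) = volume A := fun n =>
      (f.iter n).vol_preimage (f.iter_det hjac n) hAm
    refine tendsto_nhds_unique ht ?_
    exact tendsto_const_nhds.congr fun n => (hc n).symm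
  have h1 : volume A = 1 := by
    rcases herg B hBm hBinv with h | h
    · rw [hvol] at h; exact absurd h hpos.ne'
    · rwa [hvol] at h
  have h2 : volume Aᶜ = 0 := (prob_compl_eq_zero_iff hAm).2 h1
  have h3 : Aᶜ = ∅ := (isClosed_closure.isOpen_compl.measure_eq_zero_iff volume).1 h2
  rw [dense_iff_closure_eq, ← hA]
  exact compl_empty_iff.1 h3

end TorusMap

theorem curve_taylor {σ : ℝ → V2} (hσ : ContDiff ℝ 2 σ) (t0 : ℝ) :
    ∃ M τ : ℝ, 0 < M ∧ 0 < τ ∧ ∀ t, |t - t0| ≤ τ →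
      ‖σ t - σ t0 - (t - t0) • deriv σ t0‖ ≤ M * (t - t0) ^ 2 := by
  have hd1 : ContDiff ℝ 1 (deriv σ) := by
    have : ContDiff ℝ (1 + 1) σ := by norm_num; exact hσ
    exact (contDiff_succ_iff_deriv.1 this).2.2
  have hdiff : Differentiable ℝ σ := hσ.differentiable (by norm_num)
  have hb := ((hd1.differentiable (by norm_num)) t0).hasDerivAt.isBigO_sub
  obtain ⟨M, hM, hb⟩ := hb.exists_pos
  rw [Asymptotics.IsBigOWith] at hb
  obtain ⟨τ, hτ, hb⟩ := Metric.eventually_nhds_iff.1 hb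
  refine ⟨M, τ / 2, hM, by positivity, fun t ht => ?_⟩
  have h1 : ∀ x ∈ Metric.closedBall t0 |t - t0|,
      HasDerivWithinAt (fun x => σ x - x • deriv σ t0) (deriv σ x - deriv σ t0)
        (Metric.closedBall t0 |t - t0|) x := by
    intro x _
    have := (hdiff x).hasDerivAt.sub ((hasDerivAt_id x).smul_const (deriv σ t0))
    simp only [one_smul] at this
    exact this.hasDerivWithinAt
  have h2 : ∀ x ∈ Metric.closedBall t0 |t - t0|, ‖deriv σ x - deriv σ t0‖ ≤ M * |t - t0| := by
    intro x hx
    rw [Metric.mem_closedBall] at hx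
    refine (hb (by linarith)).trans ?_
    gcongr
    rw [Real.norm_eq_abs]
    exact hx
  have h3 := Convex.norm_image_sub_le_of_norm_hasDerivWithin_le h1 h2 (convex_closedBall _ _)
    (Metric.mem_closedBall_self (abs_nonneg _)) (show t ∈ Metric.closedBall t0 |t - t0| from by
      rw [Metric.mem_closedBall]; exact le_refl _)
  rw [Real.norm_eq_abs, mul_assoc, abs_mul_abs_self] at h3
  calc _ = ‖σ t - t • deriv σ t0 - (σ t0 - t0 • deriv σ t0)‖ := by
        congr 1; rw [sub_smul]; abel
    _ ≤ _ := h3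
    _ = _ := by ring

theorem start_state {S : Set T2} {σ : ℝ → V2} (hσ : ContDiff ℝ 2 σ) (h0 : deriv σ (1 / 2) ≠ 0)
    (hS : ∀ t ∈ Icc (0:ℝ) 1, proj (σ t) ∈ S) {η A α φ : ℝ} (hη : 0 < η) (hα : 0 < α)
    (hφ : 0 < φ) : ∃ ρ > 0, ∀ y ∈ Metric.ball (σ (1 / 2)) ρ, Gd S η A α (proj y) φ := by
  obtain ⟨M, τ, hM, hτ, htay⟩ := curve_taylor hσ (1 / 2)
  set u := deriv σ (1 / 2) with hu
  set s := ‖u‖ with hs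
  have hs0 : 0 < s := norm_pos_iff.2 h0
  set v := s⁻¹ • u with hv
  have hv1 : ‖v‖ = 1 := by rw [hv, norm_smul, norm_inv, ← hs, Real.norm_eq_abs, abs_of_pos hs0,
    inv_mul_cancel₀ hs0.ne']
  set η' := min η (s ^ 2 / (8 * M)) with hη'
  have hη'0 : 0 < η' := lt_min hη (by positivity)
  have hη'1 : η' ≤ η := min_le_left _ _
  have hη'2 : η' ≤ s ^ 2 / (8 * M) := min_le_right _ _
  have hev1 : ∀ᶠ R in 𝓝 (0:ℝ), A * (R ^ 2 / η') ^ α + (R / η') ^ (2 * α) < φ := by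
    have hc : Continuous fun R : ℝ => A * (R ^ 2 / η') ^ α + (R / η') ^ (2 * α) := by
      refine (continuous_const.mul (Continuous.rpow_const (by fun_prop) fun x => Or.inr hα.le)).add
        (Continuous.rpow_const (by fun_prop) fun x => Or.inr (by positivity))
    have := hc.tendsto 0
    refine this.eventually_lt_const ?_
    simp only [zero_div, ne_eq, OfNat.ofNat_ne_zero, not_false_eq_true, zero_pow]
    rw [Real.zero_rpow hα.ne', Real.zero_rpow (by positivity)]
    simpa using hφ
  have hev2 : ∀ᶠ R in 𝓝 (0:ℝ), R < min (min (s ^ 2 / (8 * M)) (s * τ / 2)) (s / 4) :=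
    Iio_mem_nhds (lt_min (lt_min (by positivity) (by positivity)) (by positivity))
  obtain ⟨R, ⟨hR1, hR2⟩, hR0⟩ := (((hev1.and hev2).filter_mono nhdsWithin_le_nhds).and
    (self_mem_nhdsWithin (s := Ioi (0:ℝ)))).exists
  have hR0 : 0 < R := hR0
  have hRa : R ≤ s ^ 2 / (8 * M) := hR2.le.trans ((min_le_left _ _).trans (min_le_left _ _))
  have hRb : R ≤ s * τ / 2 := hR2.le.trans ((min_le_left _ _).trans (min_le_right _ _))
  have hRc : R ≤ s / 4 := hR2.le.trans (min_le_right _ _)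
  set r := R ^ 2 / η' with hr
  have hr0 : 0 < r := by positivity
  set h := 2 * R / s with hh
  have hh0 : 0 < h := by positivity
  have hhs : h * s = 2 * R := by rw [hh]; field_simp
  have hhτ : h ≤ τ := by rw [hh, div_le_iff₀ hs0]; linarith
  have hh2 : h ≤ 1 / 2 := by rw [hh, div_le_iff₀ hs0]; linarith
  have hMh : M * h ^ 2 ≤ r / 2 := by
    have e : M * h ^ 2 = R ^ 2 * (4 * M / s ^ 2) := by rw [hh]; field_simp; norm_num
    rw [e, hr, div_div, div_eq_mul_inv (R ^ 2)]
    gcongr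
    rw [le_div_iff₀ (by positivity)] at hη'2
    rw [div_le_iff₀ (by positivity), inv_mul_eq_div, le_div_iff₀ (by positivity)]
    linarith
  have hMh2 : M * h ^ 2 ≤ R / 2 := by
    have e : M * h ^ 2 = R * (R * (8 * M) / s ^ 2) / 2 := by rw [hh]; field_simp; norm_num
    rw [e]
    rw [le_div_iff₀ (by positivity)] at hRa
    have : R * (8 * M) / s ^ 2 ≤ 1 := by rw [div_le_one (by positivity)]; exact hRa
    nlinarith
  have hvu : om v u = 0 := by rw [hv, om_smul_left, om_self, mul_zero]
  have hvu' : ip v u = s := by rw [hv, ip_smul_left, ip_self, ← hs, sq, inv_mul_cancel_left₀ hs0.ne']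
  refine ⟨min (R / 2) (r / 2), lt_min (by positivity) (by positivity), fun y hy => ?_⟩
  rw [Metric.mem_ball, dist_eq_norm] at hy
  have hy1 : ‖y - σ (1 / 2)‖ ≤ R / 2 := hy.le.trans (min_le_left _ _)
  have hy2 : ‖y - σ (1 / 2)‖ ≤ r / 2 := hy.le.trans (min_le_right _ _)
  have hdec : ∀ t ∈ Icc (1 / 2 - h) (1 / 2 + h), ∃ e : V2, ‖e‖ ≤ M * h ^ 2 ∧
      σ t - y = (t - 1 / 2) • u + e - (y - σ (1 / 2)) := by
    intro t ht
    have ht' : |t - 1 / 2| ≤ h := abs_le.2 ⟨by linarith [ht.1], by linarith [ht.2]⟩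
    refine ⟨σ t - σ (1 / 2) - (t - 1 / 2) • u, (htay t (ht'.trans hhτ)).trans ?_, by abel⟩
    gcongr ?_ * ?_
    rw [← sq_abs]
    exact pow_le_pow_left₀ (abs_nonneg _) ht' 2
  have hip : ∀ t ∈ Icc (1 / 2 - h) (1 / 2 + h), |ip v (σ t - y) - (t - 1 / 2) * s| ≤ R := by
    intro t ht
    obtain ⟨e, he, hE⟩ := hdec t ht
    rw [hE, ip_sub, ip_add, ip_smul, hvu']
    have h1 := abs_ip_le v e
    have h2 := abs_ip_le v (y - σ (1 / 2))
    rw [hv1, one_mul] at h1 h2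
    rw [show ∀ x y u : ℝ, x + y - u - x = y - u from fun x y u => by ring]
    have h3 := abs_sub (ip v e) (ip v (y - σ (1 / 2)))
    linarith
  refine ⟨y, v, r, R, rfl, hv1, hr0, hR0, ?_, ?_, ?_⟩
  · have : η' * r = R ^ 2 := by rw [hr]; field_simp
    rw [← this]; gcongr
  · refine St.mk' (a := 1 / 2 - h) (b := 1 / 2 + h) (γ := σ) hR0.le (by linarith)
      hσ.continuous.continuousOn (fun t ht => ⟨hS t ⟨by linarith [ht.1], by linarith [ht.2]⟩, ?_⟩) ?_ ?_
    · obtain ⟨e, he, hE⟩ := hdec t ht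
      rw [hE, om_sub, om_add, om_smul, hvu, mul_zero, zero_add]
      have h1 := abs_om_le v e
      have h2 := abs_om_le v (y - σ (1 / 2))
      rw [hv1, one_mul] at h1 h2
      have h3 := abs_sub (om v e) (om v (y - σ (1 / 2)))
      linarith
    · have := (abs_le.1 (hip (1 / 2 - h) ⟨le_refl _, by linarith⟩)).2
      have e : (1 / 2 - h - 1 / 2) * s = -(2 * R) := by rw [← hhs]; ring
      rw [e] at this
      linarith
    · have := (abs_le.1 (hip (1 / 2 + h) ⟨by linarith, le_refl _⟩)).1
      have e : (1 / 2 + h - 1 / 2) * s = 2 * R := by rw [← hhs]; ring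
      rw [e] at this
      linarith
  · have : r / R = R / η' := by rw [hr]; field_simp
    rw [this]
    exact hR1.le

theorem dense_main (f : TorusMap 2)
    (hjac : ∀ x : T2, f.detD x = (f.deg : ℝ))
    (hI : ∀ x : T2, 0 < f.Isup x)
    (herg : ∀ A : Set T2, MeasurableSet A → f.toFun ⁻¹' A = A →
      (volume : Measure T2) A = 0 ∨ (volume : Measure T2) A = 1)
    (σ : ℝ → V2) (hσ : ContDiff ℝ 2 σ) (hreg : ∀ t ∈ Set.Icc (0 : ℝ) 1, deriv σ t ≠ 0) :
      Dense (⋃ n : ℕ, f.toFun^[n] ⁻¹' ((fun t => proj (σ t)) '' Set.Icc (0 : ℝ) 1)) := by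
  set S := ⋃ n : ℕ, f.toFun^[n] ⁻¹' ((fun t => proj (σ t)) '' Set.Icc (0 : ℝ) 1) with hSdef
  have hS : f.toFun ⁻¹' S ⊆ S := by
    intro x hx
    rw [mem_preimage, hSdef, mem_iUnion] at hx
    obtain ⟨n, hn⟩ := hx
    rw [mem_preimage, ← Function.iterate_succ_apply] at hn
    exact mem_iUnion.2 ⟨n + 1, hn⟩
  have hσS : ∀ t ∈ Icc (0:ℝ) 1, proj (σ t) ∈ S := fun t ht => mem_iUnion.2 ⟨0, t, ht, rfl⟩
  obtain ⟨N, μ, η, A, α, Φ0, K, hμ0, hμ1, hη, hη1, hA, hα, hΦ0, hK, hall⟩ := f.engine hjac hI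
  obtain ⟨ha, hb⟩ := hall S hS
  obtain ⟨ρ, hρ, hstart⟩ := start_state (A := A) (φ := Φ0 / 4) hσ (hreg (1 / 2) ⟨by norm_num, by norm_num⟩)
    hσS hη hα (by positivity)
  have hBo : IsOpen (proj '' Metric.ball (σ (1 / 2)) ρ) :=
    proj_localHomeo.isOpenMap _ Metric.isOpen_ball
  have hvol := f.vol_closure_ge hjac hμ0 hμ1 hA hα hΦ0 hK ha hb hBo (by
    rintro x ⟨y, hy, rfl⟩; exact hstart y hy)
  have hBpos : 0 < volume (proj '' Metric.ball (σ (1 / 2)) ρ) :=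
    hBo.measure_pos volume ⟨_, mem_image_of_mem _ (Metric.mem_ball_self hρ)⟩
  refine f.dense_of_vol_pos hjac herg hS ?_
  by_contra hcon
  rw [not_lt, nonpos_iff_eq_zero] at hcon
  rw [hcon, mul_zero] at hvol
  exact absurd hBpos (not_lt.2 hvol)

/-- Let `f ∈ ℱ₀`, i.e. `f` is a `C²` local diffeomorphism of `𝕋²` with
`det Df_x = deg f` and `I_f(x) > 0` for every `x` (hence `f` preserves Lebesgue measure),
and assume `(f, Leb)` is ergodic. Then for every regular `C²` curve `σ : [0,1] → 𝕋²`
(represented by a lift to `ℝ²`), the union of all preimages `⋃_{n ≥ 0} f^{-n}(σ)` is dense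
in `𝕋²`. -/
theorem dense_preimages_of_curves (f : TorusMap 2)
    (hjac : ∀ x : T2, f.detD x = (f.deg : ℝ))
    (hI : ∀ x : T2, 0 < f.Isup x)
    (herg : ∀ A : Set T2, MeasurableSet A → f.toFun ⁻¹' A = A →
      (volume : Measure T2) A = 0 ∨ (volume : Measure T2) A = 1) :
    ∀ σ : ℝ → V2, ContDiff ℝ 2 σ → (∀ t ∈ Set.Icc (0 : ℝ) 1, deriv σ t ≠ 0) →
      Dense (⋃ n : ℕ, f.toFun^[n] ⁻¹' ((fun t => proj (σ t)) '' Set.Icc (0 : ℝ) 1)) := by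
  exact dense_main f hjac hI herg

end
end
end

section
/- Let (X,𝔅,η) be a probability space and E:X→𝒫(ℕ) a measurable map (i.e. {x : n∈E(x)}∈𝔅 for every n). Suppose there are β > 0 and A∈𝔅 with η(A) > 0 such that the upper asymptotic density d̄(E(x)) > β for every x∈A. Then there exist a strictly increasing sequence (n_k), a set F⊆ℕ, and measurable subsets A_{n_k}⊆A such that: (1) F is Fölner along (n_k) and, for every k, ∂F_{n_k} ⊆ E(x) for every x∈A_{n_k}; (2) η(A_{n_k}) ≥ n_k^{−2} e^{−n_k δ_k} for every k, with δ_k → 0 as k → ∞; (3) liminf_k inf_{x∈A_{n_k}} #(F_{n_k} ∩ E(x))/n_k ≥ β (in particular F has lower asymptotic density at least β along (n_k)); (4) limsup_k sup_{x∈A_{n_k}} #(F_{n_k} ∖ Fill^N(E(x)))/n_k → 0 as N → ∞. -/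
open MeasureTheory Filter Topology Set
open scoped ENNReal NNReal Classical

noncomputable section


/-- `E ∩ {0, …, n-1}` as a finset. -/
def sec (E : Set ℕ) (n : ℕ) : Finset ℕ := (Finset.range n).filter (· ∈ E)

/-- `#(E ∩ {0, …, n-1})`. -/
def secCard (E : Set ℕ) (n : ℕ) : ℕ := (sec E n).card

/-- The boundary `∂E` of a set of integers: the points of `E` one of whose neighbours
(in `ℤ`) lies outside of `E`. -/
def bdry (E : Set ℕ) : Set ℕ := {k | k ∈ E ∧ ((k + 1) ∉ E ∨ k = 0 ∨ (k - 1) ∉ E)}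

/-- The upper asymptotic density of `E` along the subsequence `(n_k)`. -/
def upDensAlong (E : Set ℕ) (nk : ℕ → ℕ) : ℝ :=
  Filter.limsup (fun k => (secCard E (nk k) : ℝ) / (nk k : ℝ)) Filter.atTop

/-- The lower asymptotic density of `E` along the subsequence `(n_k)`. -/
def loDensAlong (E : Set ℕ) (nk : ℕ → ℕ) : ℝ :=
  Filter.liminf (fun k => (secCard E (nk k) : ℝ) / (nk k : ℝ)) Filter.atTop

/-- The upper asymptotic density of `E`. -/
def upDens (E : Set ℕ) : ℝ :=
  Filter.limsup (fun n => (secCard E n : ℝ) / (n : ℝ)) Filter.atTop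

/-- `F` is Fölner along `(n_k)`: its boundary has zero upper asymptotic density along
`(n_k)`. -/
def FolnerAlong (F : Set ℕ) (nk : ℕ → ℕ) : Prop := upDensAlong (bdry F) nk = 0

/-- `Fill^N(E)`: the union of all integer intervals `[a, b)` with `a, b ∈ E` and
`0 < b - a ≤ N`. -/
def fill (N : ℕ) (E : Set ℕ) : Set ℕ :=
  {k | ∃ a ∈ E, ∃ b ∈ E, a ≤ k ∧ k < b ∧ a < b ∧ b - a ≤ N}

/-- The averaged push-forward measure `μ^{F_n} = (1/#F_n) ∑_{j ∈ F_n} T^j_* μ`. -/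
def avgMeas {X : Type*} [MeasurableSpace X] (T : X → X) (F : Set ℕ) (μ : Measure X)
    (n : ℕ) : Measure X :=
  ((secCard F n : ℝ≥0∞))⁻¹ • ∑ j ∈ sec F n, Measure.map (T^[j]) μ

/-- `ν` is a weak* cluster point of the sequence of measures `s`, i.e. the weak* limit of
a subsequence. -/
def WeakClusterPt {X : Type*} [MeasurableSpace X] [TopologicalSpace X]
    (ν : Measure X) (s : ℕ → Measure X) : Prop :=
  ∃ φ : ℕ → ℕ, StrictMono φ ∧
    ∀ g : C(X, ℝ), Tendsto (fun k => ∫ x, g x ∂(s (φ k))) atTop (𝓝 (∫ x, g x ∂ν))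



/-- Blockwise hull of `S` at scale `2^m`. -/
def hullB (m : ℕ) (S : Set ℕ) : Set ℕ :=
  {k | ∃ a ∈ S, ∃ b ∈ S, a ≤ k ∧ k ≤ b ∧ a / 2 ^ m = b / 2 ^ m}

theorem subset_hullB (m : ℕ) (S : Set ℕ) : S ⊆ hullB m S :=
  fun a ha => ⟨a, ha, a, ha, le_rfl, le_rfl, rfl⟩

theorem hullB_mono_set (m : ℕ) {S S' : Set ℕ} (h : S ⊆ S') : hullB m S ⊆ hullB m S' := by
  rintro k ⟨a, ha, b, hb, h1⟩
  exact ⟨a, h ha, b, h hb, h1⟩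

theorem hullB_mono {m m' : ℕ} (h : m ≤ m') (S : Set ℕ) : hullB m S ⊆ hullB m' S := by
  rintro k ⟨a, ha, b, hb, h1, h2, h3⟩
  refine ⟨a, ha, b, hb, h1, h2, ?_⟩
  obtain ⟨d, rfl⟩ := Nat.exists_eq_add_of_le h
  rw [pow_add, ← Nat.div_div_eq_div_mul, ← Nat.div_div_eq_div_mul, h3]

theorem block_mid {M a k b : ℕ} (h1 : a ≤ k) (h2 : k ≤ b) (h : a / M = b / M) :
    k / M = a / M := by
  have := Nat.div_le_div_right (c := M) h1
  have := Nat.div_le_div_right (c := M) h2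
  omega

theorem hullB_convex {m : ℕ} {S : Set ℕ} {k l k' : ℕ} (hk : k ∈ hullB m S) (hk' : k' ∈ hullB m S)
    (h : k / 2 ^ m = k' / 2 ^ m) (h1 : k ≤ l) (h2 : l ≤ k') : l ∈ hullB m S := by
  obtain ⟨a, ha, b, hb, h3, h4, h5⟩ := hk
  obtain ⟨a', ha', b', hb', h3', h4', h5'⟩ := hk'
  refine ⟨a, ha, b', hb', by omega, by omega, ?_⟩
  have := block_mid h3 h4 h5
  have := block_mid h3' h4' h5'
  omega

theorem bdry_hullB (m : ℕ) (S : Set ℕ) : bdry (hullB m S) ⊆ S := by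
  rintro k ⟨⟨a, ha, b, hb, h1, h2, h3⟩, h⟩
  by_contra hk
  have h4 : a ≠ k := fun h => hk (h ▸ ha)
  have h5 : b ≠ k := fun h => hk (h ▸ hb)
  rcases h with h | h | h
  · exact h ⟨a, ha, b, hb, by omega, by omega, h3⟩
  · omega
  · exact h ⟨a, ha, b, hb, by omega, by omega, h3⟩

theorem secCard_mono {D D' : Set ℕ} (n : ℕ) (h : D ⊆ D') : secCard D n ≤ secCard D' n := by
  unfold secCard sec
  apply Finset.card_le_card
  intro k
  simp only [Finset.mem_filter]
  exact fun hk => ⟨hk.1, h hk.2⟩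

theorem secCard_union (D D' : Set ℕ) (n : ℕ) :
    secCard (D ∪ D') n ≤ secCard D n + secCard D' n := by
  unfold secCard sec
  refine le_trans (Finset.card_le_card ?_) (Finset.card_union_le _ _)
  intro k
  simp only [Finset.mem_filter, Finset.mem_union, Set.mem_union]
  tauto

theorem secCard_diff {D D' : Set ℕ} (h : D ⊆ D') (n : ℕ) :
    secCard (D' \ D) n + secCard D n = secCard D' n := by
  unfold secCard sec
  rw [← Finset.card_union_of_disjoint]
  · congr 1
    ext k
    simp only [Finset.mem_filter, Finset.mem_union, Set.mem_sdiff]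
    have := @h k
    tauto
  · rw [Finset.disjoint_left]
    intro k
    simp only [Finset.mem_filter, Set.mem_sdiff]
    tauto

theorem secCard_Iio (p n : ℕ) : secCard (Set.Iio p) n ≤ p := by
  unfold secCard sec
  refine le_trans (Finset.card_le_card (t := Finset.range p) ?_) (by simp)
  intro k
  simp only [Finset.mem_filter, Finset.mem_range, Set.mem_Iio]
  tauto

theorem secCard_le (D : Set ℕ) (n : ℕ) : secCard D n ≤ n := by
  unfold secCard sec
  exact (Finset.card_filter_le _ _).trans (by simp)

theorem secCard_block (m : ℕ) (D : Set ℕ) (n : ℕ)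
    (h : ∀ k ∈ D, ∀ k' ∈ D, k < k' → k / 2 ^ m ≠ k' / 2 ^ m) :
    secCard D n ≤ n / 2 ^ m + 1 := by
  unfold secCard sec
  rw [← Finset.card_range (n / 2 ^ m + 1)]
  apply Finset.card_le_card_of_injOn (fun k => k / 2 ^ m)
  · intro k hk
    simp only [Finset.coe_filter, Finset.mem_range, Set.mem_ofPred_eq] at hk
    simp only [Finset.coe_range, Set.mem_Iio]
    have := Nat.div_le_div_right (c := 2 ^ m) hk.1.le
    omega
  · intro k hk k' hk' heq
    simp only [Finset.coe_filter, Finset.mem_range, Set.mem_ofPred_eq] at hk hk'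
    rcases lt_trichotomy k k' with h1 | h1 | h1
    · exact absurd heq (h k hk.2 k' hk'.2 h1)
    · exact h1
    · exact absurd heq.symm (h k' hk'.2 k hk.2 h1)

theorem secCard_bdry_hullB (m : ℕ) (S : Set ℕ) (n : ℕ) :
    secCard (bdry (hullB m S)) n ≤ 2 * (n / 2 ^ m + 1) := by
  have h1 : bdry (hullB m S) ⊆ {k | k ∈ hullB m S ∧ k + 1 ∉ hullB m S} ∪
      {k | k ∈ hullB m S ∧ (k = 0 ∨ k - 1 ∉ hullB m S)} := by
    rintro k ⟨h1, h2⟩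
    simp only [Set.mem_union, Set.mem_ofPred_eq]
    tauto
  refine (secCard_mono n h1).trans ((secCard_union _ _ _).trans ?_)
  rw [two_mul]
  apply add_le_add
  · apply secCard_block
    rintro k ⟨hk, hk1⟩ k' ⟨hk', -⟩ hlt heq
    exact hk1 (hullB_convex hk hk' heq (by omega) (by omega))
  · apply secCard_block
    rintro k ⟨hk, -⟩ k' ⟨hk', hk1⟩ hlt heq
    rcases hk1 with h | h
    · omega
    · exact h (hullB_convex hk hk' heq (by omega) (by omega))

theorem secCard_hullB_fill {m N : ℕ} (hN : 2 ^ m ≤ N) (S : Set ℕ) (n : ℕ) :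
    secCard (hullB m S \ fill N S) n ≤ n / 2 ^ m + 1 := by
  apply secCard_block
  rintro k ⟨hk, hk1⟩ k' ⟨hk', -⟩ hlt heq
  obtain ⟨a, ha, b, hb, h3, h4, h5⟩ := hk
  obtain ⟨a', ha', b', hb', h3', h4', h5'⟩ := hk'
  have e1 := block_mid h3 h4 h5
  have e2 := block_mid h3' h4' h5'
  apply hk1
  refine ⟨a, ha, b', hb', by omega, by omega, by omega, ?_⟩
  have e3 : a / 2 ^ m = b' / 2 ^ m := by omega
  have e4 := Nat.div_add_mod a (2 ^ m)
  have e5 := Nat.div_add_mod b' (2 ^ m)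
  have e6 := Nat.mod_lt b' (show 0 < 2 ^ m by positivity)
  rw [e3] at e4
  omega

/-- Decoding. -/
def decB (m b : ℕ) (c : Fin b → Fin (2 ^ (m + 1)) × Fin (2 ^ (m + 1))) : Set ℕ :=
  {k | ∃ h : k / 2 ^ m < b, ((c ⟨k / 2 ^ m, h⟩).1 : ℕ) ≤ k % 2 ^ m ∧
    k % 2 ^ m ≤ ((c ⟨k / 2 ^ m, h⟩).2 : ℕ)}

theorem exists_block_code (m : ℕ) (S : Set ℕ) (i : ℕ) :
    ∃ c : Fin (2 ^ (m + 1)) × Fin (2 ^ (m + 1)), ∀ k, k / 2 ^ m = i →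
      (k ∈ hullB m S ↔ (c.1 : ℕ) ≤ k % 2 ^ m ∧ k % 2 ^ m ≤ (c.2 : ℕ)) := by
  have hpos : 0 < 2 ^ m := by positivity
  have hps : 2 ^ (m + 1) = 2 * 2 ^ m := by ring
  have hfin : {a | a ∈ S ∧ a / 2 ^ m = i}.Finite := by
    apply (Set.finite_Iio ((i + 1) * 2 ^ m)).subset
    rintro a ⟨-, h⟩
    exact (Nat.div_lt_iff_lt_mul hpos).1 (by omega)
  by_cases hne : {a | a ∈ S ∧ a / 2 ^ m = i}.Nonempty
  · obtain ⟨a, ⟨ha, hai⟩, hmin⟩ := Set.exists_min_image _ id hfin hne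
    obtain ⟨b, ⟨hb, hbi⟩, hmax⟩ := Set.exists_max_image _ id hfin hne
    have ha1 := Nat.mod_lt a hpos
    have hb1 := Nat.mod_lt b hpos
    refine ⟨(⟨a % 2 ^ m, by omega⟩, ⟨b % 2 ^ m, by omega⟩), fun k hk => ?_⟩
    simp only
    have ea := Nat.div_add_mod a (2 ^ m)
    have eb := Nat.div_add_mod b (2 ^ m)
    have ek := Nat.div_add_mod k (2 ^ m)
    rw [hai] at ea
    rw [hbi] at eb
    rw [hk] at ek
    constructor
    · rintro ⟨a', ha', b', hb', h3, h4, h5⟩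
      have e1 := block_mid h3 h4 h5
      have h6 := hmin a' ⟨ha', by omega⟩
      have h7 := hmax b' ⟨hb', by omega⟩
      simp only [id] at h6 h7
      omega
    · rintro ⟨h1, h2⟩
      exact ⟨a, ha, b, hb, by omega, by omega, by omega⟩
  · refine ⟨(⟨1, by omega⟩, ⟨0, by omega⟩), fun k hk => ?_⟩
    simp only
    constructor
    · rintro ⟨a', ha', b', hb', h3, h4, h5⟩
      exact absurd ⟨a', ha', by have := block_mid h3 h4 h5; omega⟩ hne
    · omega

theorem exists_code (m n : ℕ) (S : Set ℕ) (hS : S ⊆ Set.Iio n) :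
    ∃ c, hullB m S = decB m (n / 2 ^ m + 1) c := by
  choose c hc using exists_block_code m S
  refine ⟨fun i => c i, ?_⟩
  ext k
  constructor
  · intro hk
    have hk' := hk
    obtain ⟨a', ha', b', hb', h3, h4, h5⟩ := hk'
    have h6 : b' < n := hS hb'
    have h7 := Nat.div_le_div_right (c := 2 ^ m) (h4.trans h6.le)
    exact ⟨by omega, (hc _ k rfl).1 hk⟩
  · rintro ⟨h, h1⟩
    exact (hc _ k rfl).2 h1

theorem card_code (m n : ℕ) (h : 2 ^ m ≤ n) :
    (Fintype.card (Fin (n / 2 ^ m + 1) → Fin (2 ^ (m + 1)) × Fin (2 ^ (m + 1))) : ℝ)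
      ≤ Real.exp (n * (4 * (m + 1) / 2 ^ m)) := by
  have h1 : Fintype.card (Fin (n / 2 ^ m + 1) → Fin (2 ^ (m + 1)) × Fin (2 ^ (m + 1)))
      = 2 ^ (2 * (m + 1) * (n / 2 ^ m + 1)) := by
    simp only [Fintype.card_fun, Fintype.card_prod, Fintype.card_fin]
    rw [← pow_add, ← pow_mul]
    congr 1
    ring
  rw [h1]
  push_cast
  have h2 : (2 : ℝ) ≤ Real.exp 1 := by
    have := Real.add_one_le_exp (1 : ℝ)
    linarith
  refine (pow_le_pow_left₀ (by norm_num) h2 _).trans ?_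
  rw [← Real.exp_nat_mul, Real.exp_le_exp]
  push_cast
  have h3 : ((n / 2 ^ m : ℕ) : ℝ) ≤ (n : ℝ) / 2 ^ m := by
    have := @Nat.cast_div_le ℝ _ _ _ n (2 ^ m)
    push_cast at this
    exact this
  have h4 : (1 : ℝ) ≤ (n : ℝ) / 2 ^ m := by
    rw [le_div_iff₀ (by positivity)]
    exact_mod_cast (by simpa using h)
  have h5 : (n : ℝ) * (4 * (m + 1) / 2 ^ m) = 2 * (m + 1) * (2 * (n / 2 ^ m)) := by ring
  rw [h5, mul_one]
  gcongr
  linarith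

theorem measurable_secCard {X : Type*} [MeasurableSpace X] (S : X → Set ℕ)
    (hS : ∀ k, MeasurableSet {x | k ∈ S x}) (n : ℕ) :
    Measurable (fun x => secCard (S x) n) := by
  have : (fun x => secCard (S x) n) =
      fun x => ∑ k ∈ Finset.range n, Set.indicator {x | k ∈ S x} (fun _ => 1) x := by
    funext x
    unfold secCard sec
    rw [Finset.card_filter]
    rfl
  rw [this]
  exact Finset.measurable_sum _ (fun k _ => measurable_const.indicator (hS k))

theorem measurable_hullB {X : Type*} [MeasurableSpace X] (S : X → Set ℕ)
    (hS : ∀ k, MeasurableSet {x | k ∈ S x}) (m k : ℕ) :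
    MeasurableSet {x | k ∈ hullB m (S x)} := by
  have : {x | k ∈ hullB m (S x)} = ⋃ a, ⋃ b, ⋃ (_ : a ≤ k ∧ k ≤ b ∧ a / 2 ^ m = b / 2 ^ m),
      ({x | a ∈ S x} ∩ {x | b ∈ S x}) := by
    ext x
    simp only [hullB, Set.mem_ofPred_eq, Set.mem_iUnion, Set.mem_inter_iff, exists_prop]
    constructor
    · rintro ⟨a, ha, b, hb, h⟩
      exact ⟨a, b, h, ha, hb⟩
    · rintro ⟨a, b, h, ha, hb⟩
      exact ⟨a, ha, b, hb, h⟩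
  rw [this]
  exact MeasurableSet.iUnion fun a => MeasurableSet.iUnion fun b =>
    MeasurableSet.iUnion fun _ => (hS a).inter (hS b)

/-- Borel-Cantelli. -/
theorem exists_time {X : Type*} [MeasurableSpace X] (η : Measure X) (A : Set X)
    (hpos : 0 < η A) (B : ℕ → Set X) (hB : ∀ x ∈ A, ∀ N, ∃ n, N ≤ n ∧ x ∈ B n) (n₀ : ℕ) :
    ∃ n, n₀ ≤ n ∧ ENNReal.ofReal (((n : ℝ) ^ 2)⁻¹) ≤ η (B n) := by
  by_contra! hcon
  have hsum : ∑' n, η (B (n + n₀)) ≠ ∞ := by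
    have hs : Summable (fun n : ℕ => (((n + n₀ : ℕ) : ℝ) ^ 2)⁻¹) :=
      (summable_nat_add_iff n₀).2 (Real.summable_nat_pow_inv.2 one_lt_two)
    refine ne_top_of_le_ne_top (hs.tsum_ofReal_ne_top) ?_
    exact ENNReal.tsum_le_tsum fun n => (hcon (n + n₀) (by omega)).le
  have h0 := measure_limsup_atTop_eq_zero hsum
  have : A ⊆ limsup (fun n => B (n + n₀)) atTop := by
    intro x hx
    rw [Filter.limsup_eq_iInf_iSup_of_nat]
    simp only [Set.iInf_eq_iInter, Set.iSup_eq_iUnion, Set.mem_iInter, Set.mem_iUnion]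
    intro i
    obtain ⟨n, hn, hx⟩ := hB x hx (i + n₀)
    refine ⟨n - n₀, by omega, ?_⟩
    rwa [Nat.sub_add_cancel (by omega)]
  exact hpos.ne' (measure_mono_null this h0)

/-- Pigeonhole. -/
theorem exists_hull {X : Type*} [MeasurableSpace X] (η : Measure X) (E : X → Set ℕ)
    (hE : ∀ n : ℕ, MeasurableSet {x | n ∈ E x}) (B : Set X) (hB : MeasurableSet B)
    (m n p : ℕ) (hn : 2 ^ m ≤ n) (r : ℝ) (hr : 0 ≤ r) (h : ENNReal.ofReal r ≤ η B) :
    ∃ T : Set ℕ, ∃ B' ⊆ B, MeasurableSet B' ∧ (∀ x ∈ B', T = hullB m (E x ∩ Set.Ico p n)) ∧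
      ENNReal.ofReal (r * Real.exp (-(n : ℝ) * (4 * (m + 1) / 2 ^ m))) ≤ η B' := by
  set ι := Fin (n / 2 ^ m + 1) → Fin (2 ^ (m + 1)) × Fin (2 ^ (m + 1)) with hι
  let C : ι → Set X := fun c => B ∩ {x | hullB m (E x ∩ Set.Ico p n) = decB m (n / 2 ^ m + 1) c}
  have hcov : B ⊆ ⋃ c, C c := by
    intro x hx
    obtain ⟨c, hc⟩ := exists_code m n (E x ∩ Set.Ico p n) (fun k hk => hk.2.2)
    exact Set.mem_iUnion.2 ⟨c, hx, hc⟩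
  have hmeas : ∀ c, MeasurableSet (C c) := by
    intro c
    refine hB.inter ?_
    have : {x | hullB m (E x ∩ Set.Ico p n) = decB m (n / 2 ^ m + 1) c} =
        ⋂ k, {x | k ∈ hullB m (E x ∩ Set.Ico p n) ↔ k ∈ decB m (n / 2 ^ m + 1) c} := by
      ext x
      simp [Set.ext_iff]
    rw [this]
    refine MeasurableSet.iInter fun k => ?_
    have h1 : MeasurableSet {x | k ∈ hullB m (E x ∩ Set.Ico p n)} := by
      apply measurable_hullB
      intro k
      exact (hE k).inter (MeasurableSet.const (k ∈ Set.Ico p n))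
    by_cases hk : k ∈ decB m (n / 2 ^ m + 1) c
    · simpa [hk] using h1
    · simp only [hk, iff_false]
      exact h1.compl
  by_contra! hcon
  have hlt : ∀ c, η (C c) < ENNReal.ofReal (r * Real.exp (-(n : ℝ) * (4 * (m + 1) / 2 ^ m))) :=
    fun c => hcon (decB m (n / 2 ^ m + 1) c) (C c) Set.inter_subset_left (hmeas c)
      (fun x hx => hx.2.symm)
  have hne : Nonempty ι := ⟨fun _ => (⟨0, by positivity⟩, ⟨0, by positivity⟩)⟩
  have h1 : η B < ∑ c : ι, ENNReal.ofReal (r * Real.exp (-(n : ℝ) * (4 * (m + 1) / 2 ^ m))) := by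
    refine lt_of_le_of_lt ((measure_mono hcov).trans (measure_iUnion_fintype_le _ _)) ?_
    exact ENNReal.sum_lt_sum_of_nonempty Finset.univ_nonempty (fun c _ => hlt c)
  have h2 : ∑ c : ι, ENNReal.ofReal (r * Real.exp (-(n : ℝ) * (4 * (m + 1) / 2 ^ m)))
      ≤ ENNReal.ofReal r := by
    rw [Finset.sum_const, nsmul_eq_mul, ← ENNReal.ofReal_natCast, ← ENNReal.ofReal_mul (by positivity)]
    apply ENNReal.ofReal_le_ofReal
    have h3 := card_code m n hn
    rw [Finset.card_univ]
    have h4 : Real.exp (-(n : ℝ) * (4 * (m + 1) / 2 ^ m)) =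
        (Real.exp (n * (4 * (m + 1) / 2 ^ m)))⁻¹ := by
      rw [← Real.exp_neg]; congr 1; ring
    rw [h4]
    have h5 := Real.exp_pos (n * (4 * (m + 1) / 2 ^ m))
    calc _ ≤ Real.exp (n * (4 * (m + 1) / 2 ^ m)) * (r * (Real.exp (n * (4 * (m + 1) / 2 ^ m)))⁻¹) := by
          gcongr
      _ = r := by field_simp
  exact absurd (h1.trans_le (h2.trans h)) (lt_irrefl _)

theorem exists_level (G : Set ℕ) (hG : ∀ N, ∃ n, N ≤ n ∧ n ∈ G) (c : ℕ → ℕ → ℕ)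
    (hc : ∀ j n, c j n ≤ n) (ε : ℚ) (hε : 0 < ε) :
    ∃ (q : ℚ) (m : ℕ), (∀ N, ∃ n, N ≤ n ∧ n ∈ G ∧ (q : ℝ) * n < c m n) ∧
      ∀ j, ∃ N, ∀ n, N ≤ n → n ∈ G → (c j n : ℝ) ≤ (q + ε) * n := by
  by_contra! hcon
  have key : ∀ t : ℕ, ∃ m, ∀ N, ∃ n, N ≤ n ∧ n ∈ G ∧ (((-1 + t * ε : ℚ)) : ℝ) * n < c m n := by
    intro t
    induction t with
    | zero =>
      refine ⟨0, fun N => ?_⟩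
      obtain ⟨n, hn, hg⟩ := hG (N + 1)
      refine ⟨n, by omega, hg, ?_⟩
      have h1 : (0 : ℝ) < n := by exact_mod_cast (by omega : 0 < n)
      have h2 : (0 : ℝ) ≤ c 0 n := by positivity
      push_cast
      linarith
    | succ t ih =>
      obtain ⟨m, hm⟩ := ih
      obtain ⟨j, hj⟩ := hcon _ m hm
      refine ⟨j, fun N => ?_⟩
      obtain ⟨n, hn, hg, h⟩ := hj N
      refine ⟨n, hn, hg, ?_⟩
      refine lt_of_eq_of_lt ?_ h
      push_cast
      ring
  obtain ⟨t, ht⟩ := exists_nat_gt (2 / ε)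
  obtain ⟨m, hm⟩ := key t
  obtain ⟨n, hn, hg, h⟩ := hm 0
  have h1 : (c m n : ℝ) ≤ n := by exact_mod_cast hc m n
  rw [div_lt_iff₀ hε] at ht
  have h2 : (1 : ℝ) ≤ ((-1 + t * ε : ℚ) : ℝ) := by exact_mod_cast (by linarith : (1 : ℚ) ≤ -1 + t * ε)
  have h3 : (0 : ℝ) ≤ n := by positivity
  nlinarith

/-- State of the recursive construction. -/
structure FState (X : Type*) where
  n : ℕ
  m : ℕ
  A : Set X
  G : X → Set ℕ
  T : Set ℕ
  Q : Finset (ℕ × ℝ)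

/-- Admissible states. -/
structure FState.Good {X : Type*} [MeasurableSpace X] (η : Measure X) (E : X → Set ℕ) (β : ℝ)
    (s : FState X) : Prop where
  measA : MeasurableSet s.A
  pos : 0 < η s.A
  measG : ∀ n, MeasurableSet {x | n ∈ s.G x}
  inf : ∀ x ∈ s.A, ∀ N, ∃ n, N ≤ n ∧ n ∈ s.G x
  dens : ∀ x ∈ s.A, ∀ n ∈ s.G x, β * n < secCard (E x) n
  bud : ∀ p ∈ s.Q, ∀ x ∈ s.A, ∀ j, ∃ N, ∀ n, N ≤ n → n ∈ s.G x →
    (secCard (hullB j (E x)) n : ℝ) ≤ secCard (hullB p.1 (E x)) n + p.2 * n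

/-- One step of the recursive construction. -/
structure FState.Step {X : Type*} [MeasurableSpace X] (η : Measure X) (E : X → Set ℕ) (β : ℝ)
    (s t : FState X) : Prop where
  hm : s.m < t.m
  hn : (s.m + 1) * (s.n + 1) ≤ t.n
  hmn : 2 ^ t.m * (t.m + 1) ≤ t.n
  hA : t.A ⊆ s.A
  hQ : s.Q ⊆ t.Q
  hQm : (t.m, (1 : ℝ) / (s.m + 1)) ∈ t.Q
  hT : ∀ x ∈ t.A, t.T = hullB t.m (E x ∩ Set.Ico s.n t.n)
  dens : ∀ x ∈ t.A, β * t.n < secCard (E x) t.n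
  bud : ∀ x ∈ t.A, ∀ p ∈ t.Q,
    (secCard (hullB t.m (E x)) t.n : ℝ) ≤ secCard (hullB p.1 (E x)) t.n + p.2 * t.n
  meas : ENNReal.ofReal (((t.n : ℝ) ^ 2)⁻¹ * Real.exp (-(t.n : ℝ) * (4 * (t.m + 1) / 2 ^ t.m)))
    ≤ η t.A

theorem exists_uniform_bound {α : Type*} (Q : Finset α) (P : α → ℕ → Prop)
    (h : ∀ p ∈ Q, ∃ N, ∀ n, N ≤ n → P p n) : ∃ N, ∀ n, N ≤ n → ∀ p ∈ Q, P p n := by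
  have : ∀ᶠ n in atTop, ∀ p ∈ Q, P p n := by
    rw [Filter.eventually_all_finset]
    intro p hp
    exact Filter.eventually_atTop.2 (h p hp)
  exact Filter.eventually_atTop.1 this

theorem exists_step {X : Type*} [MeasurableSpace X] (η : Measure X) (E : X → Set ℕ)
    (hE : ∀ n : ℕ, MeasurableSet {x | n ∈ E x}) (β : ℝ) (s : FState X) (hs : s.Good η E β) :
    ∃ t : FState X, t.Good η E β ∧ FState.Step η E β s t := by
  have hH : ∀ j n, Measurable (fun x => secCard (hullB j (E x)) n) := fun j n =>
    measurable_secCard _ (fun k => measurable_hullB E hE j k) n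
  have hHr : ∀ j n, Measurable (fun x => (secCard (hullB j (E x)) n : ℝ)) := fun j n =>
    (measurable_from_top (f := fun k : ℕ => (k : ℝ))).comp (hH j n)
  set ε : ℚ := 1 / (s.m + 1) with hε
  have hεpos : 0 < ε := by positivity
  -- choice of level
  let A1 : ℚ × ℕ → Set X := fun qm => s.A ∩
    ({x | ∀ N, ∃ n, N ≤ n ∧ n ∈ s.G x ∧ (qm.1 : ℝ) * n < secCard (hullB qm.2 (E x)) n} ∩
     {x | ∀ j, ∃ N, ∀ n, N ≤ n → n ∈ s.G x →
      (secCard (hullB j (E x)) n : ℝ) ≤ (qm.1 + ε) * n})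
  have hlt : ∀ (q : ℝ) (m n : ℕ),
      MeasurableSet {x | q * n < (secCard (hullB m (E x)) n : ℝ)} := fun q m n =>
    measurableSet_lt measurable_const (hHr m n)
  have hA1 : ∀ qm, MeasurableSet (A1 qm) := by
    intro qm
    refine hs.measA.inter (MeasurableSet.inter ?_ ?_)
    · have : {x | ∀ N, ∃ n, N ≤ n ∧ n ∈ s.G x ∧ (qm.1 : ℝ) * n < secCard (hullB qm.2 (E x)) n} =
        ⋂ N, ⋃ n, ⋃ (_ : N ≤ n), ({x | n ∈ s.G x} ∩
          {x | (qm.1 : ℝ) * n < (secCard (hullB qm.2 (E x)) n : ℝ)}) := by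
        ext x
        simp only [Set.mem_ofPred_eq, Set.mem_iInter, Set.mem_iUnion, Set.mem_inter_iff,
          exists_prop]
      rw [this]
      exact MeasurableSet.iInter fun N => MeasurableSet.iUnion fun n => MeasurableSet.iUnion
        fun _ => (hs.measG n).inter (hlt _ _ _)
    · have : {x | ∀ j, ∃ N, ∀ n, N ≤ n → n ∈ s.G x →
          (secCard (hullB j (E x)) n : ℝ) ≤ (qm.1 + ε) * n} =
        ⋂ j, ⋃ N, ⋂ n, ⋂ (_ : N ≤ n), ({x | n ∈ s.G x}ᶜ ∪
          {x | (secCard (hullB j (E x)) n : ℝ) ≤ (qm.1 + ε) * n}) := by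
        ext x
        simp [imp_iff_not_or]
      rw [this]
      exact MeasurableSet.iInter fun j => MeasurableSet.iUnion fun N => MeasurableSet.iInter
        fun n => MeasurableSet.iInter
        fun _ => (hs.measG n).compl.union (measurableSet_le (hHr j n) measurable_const)
  have hcov : s.A ⊆ ⋃ qm, A1 qm := by
    intro x hx
    obtain ⟨q, m, h1, h2⟩ := exists_level (s.G x) (hs.inf x hx)
      (fun j n => secCard (hullB j (E x)) n) (fun j n => secCard_le _ _) ε hεpos
    exact Set.mem_iUnion.2 ⟨(q, m), hx, h1, h2⟩
  obtain ⟨⟨q, m0⟩, hqm⟩ : ∃ qm, 0 < η (A1 qm) := by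
    by_contra! hcon
    have : η (⋃ qm, A1 qm) = 0 := measure_iUnion_null fun qm => nonpos_iff_eq_zero.1 (hcon qm)
    exact hs.pos.ne' (measure_mono_null hcov this)
  -- the new level
  set m' := max m0 (s.m + 1) with hm'
  have hm0 : m0 ≤ m' := le_max_left _ _
  have hms : s.m + 1 ≤ m' := le_max_right _ _
  let Q' : Finset (ℕ × ℝ) := insert (m', (1 : ℝ) / (s.m + 1)) s.Q
  let G1 : X → Set ℕ := fun x => {n | n ∈ s.G x ∧ (q : ℝ) * n < secCard (hullB m' (E x)) n}
  have hG1 : ∀ n, MeasurableSet {x | n ∈ G1 x} := fun n => (hs.measG n).inter (hlt q m' n)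
  have hinf1 : ∀ x ∈ A1 (q, m0), ∀ N, ∃ n, N ≤ n ∧ n ∈ G1 x := by
    intro x hx N
    obtain ⟨n, hn, hg, h⟩ := hx.2.1 N
    refine ⟨n, hn, hg, h.trans_le ?_⟩
    exact_mod_cast secCard_mono n (hullB_mono hm0 (E x))
  have hbud1 : ∀ p ∈ Q', ∀ x ∈ A1 (q, m0), ∀ j, ∃ N, ∀ n, N ≤ n → n ∈ G1 x →
      (secCard (hullB j (E x)) n : ℝ) ≤ secCard (hullB p.1 (E x)) n + p.2 * n := by
    intro p hp x hx j
    rcases Finset.mem_insert.1 hp with rfl | hp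
    · obtain ⟨N, hN⟩ := hx.2.2 j
      refine ⟨N, fun n hn hg => ?_⟩
      have h1 := hN n hn hg.1
      have h2 := hg.2
      have h3 : (ε : ℝ) = 1 / (s.m + 1) := by rw [hε]; push_cast; ring
      simp only at h1 ⊢
      rw [← h3]
      linarith
    · obtain ⟨N, hN⟩ := hs.bud p hp x hx.1 j
      exact ⟨N, fun n hn hg => hN n hn hg.1⟩
  -- the times
  let B : ℕ → Set X := fun n => A1 (q, m0) ∩ ({x | n ∈ G1 x} ∩ ⋂ p ∈ Q', {x |
      (secCard (hullB m' (E x)) n : ℝ) ≤ secCard (hullB p.1 (E x)) n + p.2 * n})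
  have hBm : ∀ n, MeasurableSet (B n) := by
    intro n
    refine (hA1 _).inter ((hG1 n).inter ?_)
    refine Finset.measurableSet_biInter _ fun p _ => ?_
    exact measurableSet_le (hHr _ _) ((hHr _ _).add measurable_const)
  have hBi : ∀ x ∈ A1 (q, m0), ∀ N, ∃ n, N ≤ n ∧ x ∈ B n := by
    intro x hx N
    obtain ⟨N', hN'⟩ := exists_uniform_bound Q' (fun p n => n ∈ G1 x →
      (secCard (hullB m' (E x)) n : ℝ) ≤ secCard (hullB p.1 (E x)) n + p.2 * n)
      (fun p hp => hbud1 p hp x hx m')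
    obtain ⟨n, hn, hg⟩ := hinf1 x hx (max N N')
    refine ⟨n, (le_max_left _ _).trans hn, hx, hg, ?_⟩
    simp only [Set.mem_iInter]
    exact fun p hp => hN' n ((le_max_right _ _).trans hn) p hp hg
  obtain ⟨n, hn, hηn⟩ := exists_time η _ hqm B hBi
    ((s.m + 1) * (s.n + 1) + 2 ^ m' * (m' + 1))
  have hnm : 2 ^ m' * (m' + 1) ≤ n := by omega
  have hnm' : 2 ^ m' ≤ n := le_trans (Nat.le_mul_of_pos_right _ (by omega)) hnm
  obtain ⟨T, B', hB'B, hB'm, hT, hηB'⟩ := exists_hull η E hE (B n) (hBm n) m' n s.n hnm' _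
    (by positivity) hηn
  have hnpos : (0 : ℝ) < n := by
    have : 0 < 2 ^ m' := by positivity
    exact_mod_cast (by omega : 0 < n)
  refine ⟨⟨n, m', B', G1, T, Q'⟩, ?_, ?_⟩
  · refine ⟨hB'm, ?_, hG1, fun x hx => hinf1 x (hB'B hx).1,
      fun x hx k hk => hs.dens x (hB'B hx).1.1 k hk.1,
      fun p hp x hx => hbud1 p hp x (hB'B hx).1⟩
    refine lt_of_lt_of_le ?_ hηB'
    rw [ENNReal.ofReal_pos]
    positivity
  · refine ⟨hms, by simp only; omega, hnm, fun x hx => (hB'B hx).1.1,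
      Finset.subset_insert _ _, Finset.mem_insert_self _ _, hT,
      fun x hx => hs.dens x (hB'B hx).1.1 n (hB'B hx).2.1.1, ?_, hηB'⟩
    intro x hx p hp
    have := (hB'B hx).2.2
    simp only [Set.mem_iInter] at this
    exact this p hp

theorem secCard_mono_of {D D' : Set ℕ} (n : ℕ) (h : ∀ k, k < n → k ∈ D → k ∈ D') :
    secCard D n ≤ secCard D' n := by
  unfold secCard sec
  apply Finset.card_le_card
  intro k
  simp only [Finset.mem_filter, Finset.mem_range]
  exact fun hk => ⟨hk.1, h k hk.1 hk.2⟩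

theorem ratio_le_one (D : Set ℕ) (n : ℕ) : (secCard D n : ℝ) / n ≤ 1 := by
  apply div_le_one_of_le₀ _ (by positivity)
  exact_mod_cast secCard_le D n

theorem le_liminf_aux (β : ℝ) (u : ℕ → ℝ) (h : ∀ k : ℕ, β - 1 / ((k : ℝ) + 1) ≤ u k)
    (h1 : ∀ k, u k ≤ 1) : β ≤ Filter.liminf u atTop := by
  apply le_of_forall_lt_imp_le_of_dense
  intro c hc
  have h2 : Tendsto (fun k : ℕ => β - 1 / ((k : ℝ) + 1)) atTop (𝓝 (β - 0)) :=
    tendsto_const_nhds.sub tendsto_one_div_add_atTop_nhds_zero_nat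
  have h3 : ∀ᶠ k : ℕ in atTop, c < β - 1 / ((k : ℝ) + 1) :=
    h2.eventually (lt_mem_nhds (by simpa using hc))
  refine Filter.le_liminf_of_le ?_ (h3.mono fun k hk => hk.le.trans (h k))
  exact (Filter.isBoundedUnder_of ⟨1, h1⟩).isCoboundedUnder_ge

theorem limsup_aux (u : ℕ → ℝ) (h0 : ∀ k, 0 ≤ u k) (c : ℝ) (i : ℕ) (h : ∀ k, i ≤ k → u k ≤ c) :
    0 ≤ Filter.limsup u atTop ∧ Filter.limsup u atTop ≤ c := by
  have he : ∀ᶠ k in atTop, u k ≤ c := Filter.eventually_atTop.2 ⟨i, h⟩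
  constructor
  · exact Filter.le_limsup_of_frequently_le (Filter.Frequently.of_forall h0) ⟨c, he⟩
  · refine Filter.limsup_le_of_le ?_ he
    exact (Filter.isBoundedUnder_of ⟨0, h0⟩).isCoboundedUnder_le

theorem one_div_le_aux {a b : ℕ} (h : a ≤ b) : (1 : ℝ) / ((b : ℝ) + 1) ≤ 1 / ((a : ℝ) + 1) := by
  have : (a : ℝ) ≤ b := by exact_mod_cast h
  gcongr

theorem div_pow_aux (n m : ℕ) {k : ℕ} (hk : k ≤ m) :
    ((n / 2 ^ m : ℕ) : ℝ) ≤ n * (1 / ((k : ℝ) + 1)) := by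
  have h1 : ((n / 2 ^ m : ℕ) : ℝ) ≤ (n : ℝ) / 2 ^ m := by
    have := @Nat.cast_div_le ℝ _ _ _ n (2 ^ m)
    push_cast at this
    exact this
  refine h1.trans ?_
  rw [div_eq_mul_one_div]
  have h2 : (k : ℝ) + 1 ≤ 2 ^ m := by
    have : m < 2 ^ m := Nat.lt_two_pow_self
    exact_mod_cast (by omega : k + 1 ≤ 2 ^ m)
  gcongr

theorem tendsto_delta_aux (m : ℕ → ℕ) (hm : ∀ k, k ≤ m k) :
    Tendsto (fun k => 4 * ((m k : ℝ) + 1) / 2 ^ m k) atTop (𝓝 0) := by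
  have h1 : Tendsto (fun n : ℕ => 4 * ((n : ℝ) + 1) / 2 ^ n) atTop (𝓝 0) := by
    have e1 := tendsto_pow_const_div_const_pow_of_one_lt 1 (one_lt_two (α := ℝ))
    have e2 := tendsto_pow_const_div_const_pow_of_one_lt 0 (one_lt_two (α := ℝ))
    have e3 := (e1.add e2).const_mul 4
    simp only [add_zero, mul_zero] at e3
    refine e3.congr fun n => ?_
    simp only [pow_one, pow_zero]
    ring
  exact h1.comp (tendsto_atTop_mono hm tendsto_id)

/-- (Extraction of a good Fölner sequence from a measurable family of
sets of integers with uniformly positive upper asymptotic density.) -/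
theorem folner_extraction {X : Type*} [MeasurableSpace X]
    (η : Measure X) (hη : IsProbabilityMeasure η)
    (E : X → Set ℕ) (hE : ∀ n : ℕ, MeasurableSet {x | n ∈ E x})
    (β : ℝ) (hβ : 0 < β)
    (A : Set X) (hA : MeasurableSet A) (hApos : 0 < η A)
    (hdens : ∀ x ∈ A, β < upDens (E x)) :
    ∃ (nk : ℕ → ℕ) (F : Set ℕ) (As : ℕ → Set X),
      StrictMono nk ∧
      (∀ k, MeasurableSet (As k) ∧ As k ⊆ A) ∧
      -- (1) `F` is Fölner along `(n_k)` and `∂F_{n_k} ⊆ E(x)` for every `x ∈ A_{n_k}`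
      FolnerAlong F nk ∧
      (∀ k, ∀ x ∈ As k, bdry (F ∩ Set.Iio (nk k)) ⊆ E x) ∧
      -- (2) `η(A_{n_k}) ≥ n_k⁻² e^{-n_k δ_k}` with `δ_k → 0`
      (∃ δ : ℕ → ℝ, Tendsto δ atTop (𝓝 (0 : ℝ)) ∧ ∀ k,
        ENNReal.ofReal (((nk k : ℝ) ^ 2)⁻¹ * Real.exp (-(nk k : ℝ) * δ k)) ≤ η (As k)) ∧
      -- (3) lower density of `F` along `(n_k)` is at least `β`, more precisely:
      β ≤ Filter.liminf
          (fun k => ⨅ x : As k, (secCard (F ∩ E x.1) (nk k) : ℝ) / (nk k : ℝ)) Filter.atTop ∧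
      β ≤ loDensAlong F nk ∧
      -- (4) `E(x)` is dense in `F`, uniformly for `x ∈ A_{n_k}`
      Tendsto (fun N : ℕ => Filter.limsup
          (fun k => ⨆ x : As k, (secCard (F \ fill N (E x.1)) (nk k) : ℝ) / (nk k : ℝ))
          Filter.atTop)
        atTop (𝓝 (0 : ℝ)) := by
  let s0 : FState X := ⟨0, 0, A, fun x => {n | β * n < secCard (E x) n}, ∅, ∅⟩
  have hs0 : s0.Good η E β := by
    refine ⟨hA, hApos, fun n => ?_, fun x hx N => ?_, fun x hx n hn => hn, by simp [s0]⟩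
    · exact measurableSet_lt measurable_const
        ((measurable_from_top (f := fun k : ℕ => (k : ℝ))).comp (measurable_secCard E hE n))
    · have h1 := Filter.frequently_lt_of_lt_limsup
        ((Filter.isBoundedUnder_of ⟨0, fun n => by positivity⟩).isCoboundedUnder_le) (hdens x hx)
      obtain ⟨n, hn, h2⟩ := Filter.frequently_atTop.1 h1 (N + 1)
      refine ⟨n, by omega, ?_⟩
      have h3 : (0 : ℝ) < n := by exact_mod_cast (by omega : 0 < n)
      exact (lt_div_iff₀ h3).1 h2
  choose! nxt hnxtG hnxtS using exists_step η E hE β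
  let s : ℕ → FState X := fun k => Nat.rec s0 (fun _ t => nxt t) k
  have hG : ∀ k, (s k).Good η E β := by
    intro k
    induction k with
    | zero => exact hs0
    | succ k ih => exact hnxtG _ ih
  have hS : ∀ k, FState.Step η E β (s k) (s (k + 1)) := fun k => hnxtS _ (hG k)
  have hA0 : (s 0).A = A := rfl
  clear_value s
  have hm : ∀ k, k ≤ (s k).m := by
    intro k
    induction k with
    | zero => exact Nat.zero_le _
    | succ k ih => have := (hS k).hm; omega
  have hmmono : Monotone (fun k => (s k).m) := monotone_nat_of_le_succ fun k => (hS k).hm.le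
  have hnlt : ∀ k, (s k).n < (s (k + 1)).n := fun k => by
    have h1 := (hS k).hn
    have h2 := Nat.le_mul_of_pos_left ((s k).n + 1) (Nat.succ_pos (s k).m)
    simp only [Nat.succ_eq_add_one] at h2
    omega
  have hnmono : StrictMono (fun k => (s k).n) := strictMono_nat_of_lt_succ hnlt
  have hAanti : Antitone (fun k => (s k).A) := antitone_nat_of_succ_le fun k => (hS k).hA
  have hQmono : Monotone (fun k => (s k).Q) := monotone_nat_of_le_succ fun k => (hS k).hQ
  have hne : ∀ k, (s k).A.Nonempty := fun k => nonempty_of_measure_ne_zero (hG k).pos.ne'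
  have hnpos : ∀ k, (0 : ℝ) < (s (k + 1)).n := fun k => by
    exact_mod_cast (Nat.zero_le _).trans_lt (hnlt k)
  have hr : ∀ k : ℕ, ((s k).n : ℝ) + 1 ≤ (s (k + 1)).n * (1 / ((k : ℝ) + 1)) := by
    intro k
    have h1 := (hS k).hn
    have h2 : (k + 1) * ((s k).n + 1) ≤ (s (k + 1)).n :=
      le_trans (Nat.mul_le_mul_right _ (by have := hm k; omega)) h1
    have h3 : ((k : ℝ) + 1) * ((s k).n + 1) ≤ (s (k + 1)).n := by exact_mod_cast h2
    rw [mul_one_div, le_div_iff₀ (by positivity)]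
    linarith
  have hTsub : ∀ k, (s (k + 1)).T ⊆ Set.Ico (s k).n (s (k + 1)).n := by
    intro k j hj
    obtain ⟨x, hx⟩ := hne (k + 1)
    rw [(hS k).hT x hx] at hj
    obtain ⟨a, ha, b, hb, h1, h2, -⟩ := hj
    have := ha.2.1
    have := hb.2.2
    exact ⟨by omega, by omega⟩
  have hTbd : ∀ k, bdry (s (k + 1)).T ⊆ ⋂ x ∈ (s (k + 1)).A, E x := by
    intro k j hj
    simp only [Set.mem_iInter]
    intro x hx
    rw [(hS k).hT x hx] at hj
    exact (bdry_hullB _ _ hj).1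
  set F : Set ℕ := ⋃ k, (s (k + 1)).T with hF
  have hTF : ∀ k, (s (k + 1)).T ⊆ F := fun k => Set.subset_iUnion (fun k => (s (k + 1)).T) k
  have hFT : ∀ k j, (s k).n ≤ j → j < (s (k + 1)).n → j ∈ F → j ∈ (s (k + 1)).T := by
    intro k j h1 h2 hj
    obtain ⟨i, hi⟩ := Set.mem_iUnion.1 hj
    have h3 := hTsub i hi
    have h4 : k < i + 1 := hnmono.lt_iff_lt.1 (lt_of_le_of_lt h1 h3.2)
    have h5 : i < k + 1 := hnmono.lt_iff_lt.1 (lt_of_le_of_lt h3.1 h2)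
    obtain rfl : i = k := by omega
    exact hi
  -- counting bounds
  have b1 : ∀ k : ℕ, (secCard (bdry F) (s (k + 1)).n : ℝ) / (s (k + 1)).n
      ≤ 4 * (1 / ((k : ℝ) + 1)) := by
    intro k
    obtain ⟨x, hx⟩ := hne (k + 1)
    have h1 : secCard (bdry F) (s (k + 1)).n ≤
        (s k).n + 2 * ((s (k + 1)).n / 2 ^ (s (k + 1)).m + 1) := by
      refine (secCard_mono_of (D' := Set.Iio (s k).n ∪ bdry (s (k + 1)).T) _ ?_).trans
        ((secCard_union _ _ _).trans (add_le_add (secCard_Iio _ _) ?_))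
      · rintro j hj ⟨hjF, hb⟩
        by_cases hjn : j < (s k).n
        · exact Or.inl hjn
        · refine Or.inr ⟨hFT k j (by omega) hj hjF, ?_⟩
          rcases hb with hb | hb | hb
          · exact Or.inl fun h => hb (hTF k h)
          · exact Or.inr (Or.inl hb)
          · exact Or.inr (Or.inr fun h => hb (hTF k h))
      · rw [(hS k).hT x hx]
        exact secCard_bdry_hullB _ _ _
    have h2 : (secCard (bdry F) (s (k + 1)).n : ℝ) ≤
        (s k).n + 2 * (((s (k + 1)).n / 2 ^ (s (k + 1)).m : ℕ) + 1) := by exact_mod_cast h1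
    have h3 := div_pow_aux (s (k + 1)).n (s (k + 1)).m (k := k) (by have := hm (k + 1); omega)
    have h4 := hr k
    rw [div_le_iff₀ (hnpos k)]
    have h5 : (0 : ℝ) ≤ (s k).n := by positivity
    linarith
  have b3 : ∀ k : ℕ, ∀ x ∈ (s (k + 1)).A, β - 1 / ((k : ℝ) + 1) ≤
      (secCard (F ∩ E x) (s (k + 1)).n : ℝ) / (s (k + 1)).n := by
    intro k x hx
    have h1 : secCard (E x) (s (k + 1)).n ≤ secCard (F ∩ E x) (s (k + 1)).n + (s k).n := by
      refine (secCard_mono_of (D' := F ∩ E x ∪ Set.Iio (s k).n) _ ?_).trans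
        ((secCard_union _ _ _).trans (add_le_add le_rfl (secCard_Iio _ _)))
      intro j hj hjE
      by_cases hjn : j < (s k).n
      · exact Or.inr hjn
      · refine Or.inl ⟨hTF k ?_, hjE⟩
        rw [(hS k).hT x hx]
        exact subset_hullB _ _ ⟨hjE, by omega, hj⟩
    have h2 : (secCard (E x) (s (k + 1)).n : ℝ) ≤
      secCard (F ∩ E x) (s (k + 1)).n + (s k).n := by exact_mod_cast h1
    have h3 := (hS k).dens x hx
    have h4 := hr k
    rw [le_div_iff₀ (hnpos k)]
    linarith
  have b4 : ∀ i k N : ℕ, i ≤ k → 2 ^ (s (i + 1)).m ≤ N → ∀ x ∈ (s (k + 1)).A,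
      (secCard (F \ fill N (E x)) (s (k + 1)).n : ℝ) / (s (k + 1)).n ≤ 3 * (1 / ((i : ℝ) + 1)) := by
    intro i k N hik hN x hx
    have hmm : (s (i + 1)).m ≤ (s (k + 1)).m := hmmono (by omega)
    have h1 : secCard (F \ fill N (E x)) (s (k + 1)).n ≤ (s k).n +
        (secCard (hullB (s (k + 1)).m (E x) \ hullB (s (i + 1)).m (E x)) (s (k + 1)).n +
          ((s (k + 1)).n / 2 ^ (s (i + 1)).m + 1)) := by
      refine (secCard_mono_of (D' := Set.Iio (s k).n ∪
        ((hullB (s (k + 1)).m (E x) \ hullB (s (i + 1)).m (E x)) ∪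
          (hullB (s (i + 1)).m (E x) \ fill N (E x)))) _ ?_).trans
        ((secCard_union _ _ _).trans (add_le_add (secCard_Iio _ _)
          ((secCard_union _ _ _).trans (add_le_add le_rfl (secCard_hullB_fill hN _ _)))))
      rintro j hj ⟨hjF, hjf⟩
      by_cases hjn : j < (s k).n
      · exact Or.inl hjn
      · right
        have h2 := hFT k j (by omega) hj hjF
        rw [(hS k).hT x hx] at h2
        have h3 := hullB_mono_set _ Set.inter_subset_left h2
        by_cases h4 : j ∈ hullB (s (i + 1)).m (E x)
        · exact Or.inr ⟨h4, hjf⟩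
        · exact Or.inl ⟨h3, h4⟩
    have h2 := secCard_diff (hullB_mono hmm (E x)) (s (k + 1)).n
    have h3 := (hS k).bud x hx _ (hQmono (by omega : i + 1 ≤ k + 1) (hS i).hQm)
    simp only at h3
    have h1' : (secCard (F \ fill N (E x)) (s (k + 1)).n : ℝ) ≤ (s k).n +
        (secCard (hullB (s (k + 1)).m (E x) \ hullB (s (i + 1)).m (E x)) (s (k + 1)).n +
          (((s (k + 1)).n / 2 ^ (s (i + 1)).m : ℕ) + 1)) := by exact_mod_cast h1
    have h2' : (secCard (hullB (s (k + 1)).m (E x) \ hullB (s (i + 1)).m (E x)) (s (k + 1)).n : ℝ)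
        + secCard (hullB (s (i + 1)).m (E x)) (s (k + 1)).n =
        secCard (hullB (s (k + 1)).m (E x)) (s (k + 1)).n := by exact_mod_cast h2
    have h4 := div_pow_aux (s (k + 1)).n (s (i + 1)).m (k := i) (by have := hm (i + 1); omega)
    have h5 := hr k
    have h6 := mul_le_mul_of_nonneg_left (one_div_le_aux hik) (hnpos k).le
    have h7 := mul_le_mul_of_nonneg_right (one_div_le_aux (hm i)) (hnpos k).le
    rw [div_le_iff₀ (hnpos k)]
    linarith
  have hinst : ∀ k, Nonempty ((s (k + 1)).A) := fun k => (hne (k + 1)).to_subtype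
  refine ⟨fun k => (s (k + 1)).n, F, fun k => (s (k + 1)).A, ?_, ?_, ?_, ?_, ?_, ?_, ?_, ?_⟩
  · exact fun a b hab => hnmono (by omega)
  · exact fun k => ⟨(hG (k + 1)).measA, hA0 ▸ hAanti (Nat.zero_le (k + 1))⟩
  · unfold FolnerAlong upDensAlong
    apply Filter.Tendsto.limsup_eq
    have h1 : Tendsto (fun k : ℕ => 4 * (1 / ((k : ℝ) + 1))) atTop (𝓝 0) := by
      simpa using (tendsto_one_div_add_atTop_nhds_zero_nat (𝕜 := ℝ)).const_mul 4
    exact squeeze_zero (fun k => by positivity) b1 h1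
  · rintro k x hx j ⟨⟨hjF, hj⟩, hb⟩
    obtain ⟨i, hi⟩ := Set.mem_iUnion.1 hjF
    have h1 := hTsub i hi
    have h2 : i < k + 1 := hnmono.lt_iff_lt.1 (lt_of_le_of_lt h1.1 hj)
    have h3 : (s (i + 1)).n ≤ (s (k + 1)).n := hnmono.monotone (by omega : i + 1 ≤ k + 1)
    have h4 : j ∈ bdry (s (i + 1)).T := by
      have h5 : ∀ j', j' ∈ (s (i + 1)).T → j' ∈ F ∩ Set.Iio (s (k + 1)).n := fun j' hj' =>
        ⟨hTF i hj', lt_of_lt_of_le (hTsub i hj').2 h3⟩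
      refine ⟨hi, ?_⟩
      rcases hb with hb | hb | hb
      · exact Or.inl fun h => hb (h5 _ h)
      · exact Or.inr (Or.inl hb)
      · exact Or.inr (Or.inr fun h => hb (h5 _ h))
    have h6 := hTbd i h4
    simp only [Set.mem_iInter] at h6
    exact h6 x (hAanti (by omega : i + 1 ≤ k + 1) hx)
  · exact ⟨fun k => 4 * ((s (k + 1)).m + 1) / 2 ^ (s (k + 1)).m,
      tendsto_delta_aux _ (fun k => by have := hm (k + 1); omega), fun k => (hS k).meas⟩
  · apply le_liminf_aux
    · intro k
      exact le_ciInf fun x => b3 k x.1 x.2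
    · intro k
      obtain ⟨x, hx⟩ := hne (k + 1)
      refine (ciInf_le ⟨0, ?_⟩ (⟨x, hx⟩ : (s (k + 1)).A)).trans (ratio_le_one _ _)
      rintro _ ⟨y, rfl⟩
      positivity
  · unfold loDensAlong
    apply le_liminf_aux
    · intro k
      obtain ⟨x, hx⟩ := hne (k + 1)
      refine (b3 k x hx).trans ?_
      have h1 := secCard_mono (s (k + 1)).n (Set.inter_subset_left : F ∩ E x ⊆ F)
      gcongr
    · exact fun k => ratio_le_one _ _
  · have key : ∀ i N : ℕ, 2 ^ (s (i + 1)).m ≤ N → _ := fun i N hN => limsup_aux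
      (fun k => ⨆ x : (s (k + 1)).A, (secCard (F \ fill N (E x.1)) (s (k + 1)).n : ℝ) /
        ((s (k + 1)).n : ℝ)) (fun k => Real.iSup_nonneg fun x => by positivity)
      (3 * (1 / ((i : ℝ) + 1))) i (fun k hk => ciSup_le fun x => b4 i k N hk hN x.1 x.2)
    rw [Metric.tendsto_atTop]
    intro ε hε
    have h1 : Tendsto (fun k : ℕ => 3 * (1 / ((k : ℝ) + 1))) atTop (𝓝 0) := by
      simpa using (tendsto_one_div_add_atTop_nhds_zero_nat (𝕜 := ℝ)).const_mul 3
    obtain ⟨i, hi⟩ := (h1.eventually (gt_mem_nhds hε)).exists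
    refine ⟨2 ^ (s (i + 1)).m, fun N hN => ?_⟩
    have h2 := key i N hN
    rw [Real.dist_eq, sub_zero, abs_of_nonneg h2.1]
    exact h2.2.trans_lt hi

end
end
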